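/- arXiv:2410.16134 — 3 statements merged into one kernel-verified Lean document; each statement's English description precedes it below -/
import Mathlib

section
/- Let (T₁,…,T_k) be an anti-commuting tuple of contractions on ℂ² such that at least one T_i is a non-zero nilpotent matrix. Then there exist a complex Hilbert space K, scalars q̃_{ij} ∈ {1,−1} (1 ≤ i < j ≤ k), unitary operators U₁,…,U_k on K with U_iU_j = q̃_{ij}U_jU_i for all i < j, and a linear isometry V : ℂ² → K such that T₁^{m₁}⋯T_k^{m_k} = V* U₁^{m₁}⋯U_k^{m_k} V for all nonnegative integers m₁,…,m_k. -/
/-- The operator norm of a `2 × 2` complex matrix regarded as an operator on the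
Hilbert space `ℂ²` (i.e. `EuclideanSpace ℂ (Fin 2)`, with the `ℓ²` norm). -/
noncomputable def opNorm2 (T : Matrix (Fin 2) (Fin 2) ℂ) : ℝ :=
  ‖Matrix.toEuclideanCLM (𝕜 := ℂ) T‖

/-- `B` leaves `M` invariant and is intertwined by `Q` with `τ` on `M`. -/
def DilRel {K H : Type} [NormedAddCommGroup K] [InnerProductSpace ℂ K]
    [NormedAddCommGroup H] [InnerProductSpace ℂ H]
    (M : Submodule ℂ K) (Q : K →L[ℂ] H) (B : K →L[ℂ] K) (τ : H →L[ℂ] H) : Prop :=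
  ∀ v ∈ M, B v ∈ M ∧ Q (B v) = τ (Q v)

section abstract_part

variable {K H : Type} [NormedAddCommGroup K] [InnerProductSpace ℂ K]
    [NormedAddCommGroup H] [InnerProductSpace ℂ H]
    {M : Submodule ℂ K} {Q : K →L[ℂ] H}

theorem DilRel.one : DilRel M Q 1 1 := fun _ hv => ⟨hv, rfl⟩

theorem DilRel.mul {A B : K →L[ℂ] K} {α β : H →L[ℂ] H} (hA : DilRel M Q A α)
    (hB : DilRel M Q B β) : DilRel M Q (A * B) (α * β) := fun v hv => by
  have h1 := hB v hv
  have h2 := hA _ h1.1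
  refine ⟨h2.1, ?_⟩
  show Q (A (B v)) = α (β (Q v))
  rw [h2.2, h1.2]

theorem DilRel.add {A B : K →L[ℂ] K} {α β : H →L[ℂ] H} (hA : DilRel M Q A α)
    (hB : DilRel M Q B β) : DilRel M Q (A + B) (α + β) := fun v hv => by
  have h1 := hB v hv
  have h2 := hA v hv
  refine ⟨M.add_mem h2.1 h1.1, ?_⟩
  simp [h1.2, h2.2]

theorem DilRel.smul {A : K →L[ℂ] K} {α : H →L[ℂ] H} (c : ℂ) (hA : DilRel M Q A α) :
    DilRel M Q (c • A) (c • α) := fun v hv => by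
  have h2 := hA v hv
  refine ⟨M.smul_mem _ h2.1, ?_⟩
  simp [h2.2]

theorem DilRel.pow {A : K →L[ℂ] K} {α : H →L[ℂ] H} (hA : DilRel M Q A α) (n : ℕ) :
    DilRel M Q (A ^ n) (α ^ n) := by
  induction n with
  | zero => simpa using DilRel.one
  | succ n ih => rw [pow_succ, pow_succ]; exact ih.mul hA

theorem DilRel.list_prod {ι : Type} (l : List ι) {A : ι → K →L[ℂ] K} {α : ι → H →L[ℂ] H}
    (h : ∀ i, DilRel M Q (A i) (α i)) : DilRel M Q (l.map A).prod (l.map α).prod := by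
  induction l with
  | nil => simpa using DilRel.one
  | cons a l ih => simpa using (h a).mul ih

/-- Operator Moebius transform of a unitary. -/
theorem exists_moebius [CompleteSpace K] (hM : IsClosed (M : Set K)) (A : K →L[ℂ] K)
    (hA : A ∈ unitary (K →L[ℂ] K)) (c : ℂ) (hc : ‖c‖ ≤ 1) :
    ∃ B ∈ unitary (K →L[ℂ] K), (∀ C, Commute C A → Commute C B) ∧
      (∀ α : H →L[ℂ] H, α * α = 0 → DilRel M Q A α →
        DilRel M Q B (c • 1 + (1 - starRingEnd ℂ c * c) • α)) := by
  rcases hc.lt_or_eq with hc | hc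
  · set d := starRingEnd ℂ c with hd
    have hAn : ‖A‖ ≤ 1 := by
      rcases subsingleton_or_nontrivial (K →L[ℂ] K) with h | h
      · rw [Subsingleton.elim A 0]; simp
      · exact (CStarRing.norm_of_mem_unitary hA).le
    have hX : ‖(-d) • A‖ < 1 := by
      rw [norm_smul, norm_neg, hd, RCLike.norm_conj]
      nlinarith [norm_nonneg c, norm_nonneg A]
    set X := (-d) • A with hXd
    set R : K →L[ℂ] K := ∑' i : ℕ, X ^ i with hR
    have h1 : R * (1 - X) = 1 := geom_series_mul_neg X hX
    have h2 : (1 - X) * R = 1 := mul_neg_geom_series X hX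
    have hRC : ∀ C, Commute C A → Commute C R := by
      intro C hC
      have h3 : Commute C (1 - X) := (Commute.one_right C).sub_right (hC.smul_right _)
      show C * R = R * C
      calc C * R = (R * (1 - X)) * (C * R) := by rw [h1, one_mul]
        _ = R * ((1 - X) * C) * R := by noncomm_ring
        _ = R * (C * (1 - X)) * R := by rw [h3.eq]
        _ = R * C * ((1 - X) * R) := by noncomm_ring
        _ = R * C := by rw [h2, mul_one]
    have hAA : star A * A = 1 := (Unitary.mem_iff.mp hA).1
    have hAA' : A * star A = 1 := (Unitary.mem_iff.mp hA).2
    have hsX : star X = -(c • star A) := by simp [hXd, hd, star_smul]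
    have key : star (c • 1 + A) * (c • 1 + A) = star (1 - X) * (1 - X) := by
      rw [star_sub, hsX, hXd]
      simp only [star_add, star_smul, star_one, add_mul, mul_add, sub_mul, mul_sub, smul_mul_assoc,
        mul_smul_comm, one_mul, mul_one, hAA, neg_smul, neg_mul, mul_neg]
      have hsc : star c = d := rfl
      rw [hsc]
      module
    have key' : (c • 1 + A) * star (c • 1 + A) = (1 - X) * star (1 - X) := by
      rw [star_sub, hsX, hXd]
      simp only [star_add, star_smul, star_one, add_mul, mul_add, sub_mul, mul_sub, smul_mul_assoc,
        mul_smul_comm, one_mul, mul_one, hAA', neg_smul, neg_mul, mul_neg]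
      have hsc : star c = d := rfl
      rw [hsc]
      module
    have hcomm : Commute (c • 1 + A) R :=
      hRC _ (((Commute.one_left A).smul_left c).add_left (Commute.refl A))
    refine ⟨(c • 1 + A) * R, ?_, ?_, ?_⟩
    · rw [Unitary.mem_iff]
      constructor
      · calc star ((c • 1 + A) * R) * ((c • 1 + A) * R)
            = star R * (star (c • 1 + A) * (c • 1 + A)) * R := by rw [star_mul]; simp only [mul_assoc]
          _ = star ((1 - X) * R) * ((1 - X) * R) := by rw [key, star_mul]; simp only [mul_assoc]
          _ = 1 := by rw [h2]; simp
      · calc ((c • 1 + A) * R) * star ((c • 1 + A) * R)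
            = R * ((c • 1 + A) * star (c • 1 + A)) * star R := by
              rw [hcomm.eq, star_mul]; simp only [mul_assoc]
          _ = (R * (1 - X)) * star (R * (1 - X)) := by rw [key', star_mul]; simp only [mul_assoc]
          _ = 1 := by rw [h1]; simp
    · intro C hC
      exact (((Commute.one_right C).smul_right c).add_right hC).mul_right (hRC C hC)
    · intro α hα hAα
      have hXr : DilRel M Q X ((-d) • α) := hAα.smul _
      have hRr : DilRel M Q R (1 - d • α) := by
        intro v hv
        have hmem : R v ∈ M := by
          have hs : HasSum (fun i : ℕ => X ^ i) R := (summable_geometric_of_norm_lt_one hX).hasSum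
          have hs' := (ContinuousLinearMap.apply ℂ K v).hasSum hs
          refine hM.mem_of_tendsto hs' (Filter.Eventually.of_forall fun s => ?_)
          exact M.sum_mem fun i _ => ((hXr.pow i) v hv).1
        refine ⟨hmem, ?_⟩
        have h3 : R v - X (R v) = v := by
          have := congrArg (fun L : K →L[ℂ] K => L v) h2
          simpa [sub_mul] using this
        have h4 := (hXr _ hmem).2
        have h5 : Q v = Q (R v) + d • α (Q (R v)) := by
          rw [← h3, map_sub, h4, h3]; simp
        have h6 : α (α (Q (R v))) = 0 := congrArg (fun L : H →L[ℂ] H => L (Q (R v))) hα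
        rw [h5]
        simp [h6]
      have := ((DilRel.one.smul c).add hAα).mul hRr
      convert this using 1
      simp only [add_mul, mul_sub, smul_mul_assoc, mul_smul_comm, one_mul, mul_one, hα]
      module
  · have hcc : starRingEnd ℂ c * c = 1 := by
      rw [RCLike.conj_mul, hc]; simp
    refine ⟨c • 1, ?_, ?_, ?_⟩
    · rw [Unitary.mem_iff]
      have hcc' : star c * c = 1 := hcc
      simp only [star_smul, star_one, smul_mul_assoc, mul_smul_comm, one_mul, smul_smul,
        mul_comm c, hcc', one_smul, and_self]
    · intro C _
      exact (Commute.one_right C).smul_right c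
    · intro α _ _
      rw [hcc]
      simpa using DilRel.one.smul c

end abstract_part

/-- Weighted permutation unitaries on `ℓ²(ℤ)`. -/
theorem exists_weighted_perm (e : ℤ ≃ ℤ) (u : ℤ → ℂ) (hu : ∀ n, ‖u n‖ = 1) :
    ∃ S ∈ unitary (lp (fun _ : ℤ => ℂ) 2 →L[ℂ] lp (fun _ : ℤ => ℂ) 2),
      ∀ f n, (S f : ℤ → ℂ) n = u n * (f : ℤ → ℂ) (e n) := by
  have h2 : (0 : ℝ) < (2 : ENNReal).toReal := by simp
  have hmem : ∀ (e : ℤ ≃ ℤ) (u : ℤ → ℂ) (_ : ∀ n, ‖u n‖ = 1) (f : lp (fun _ : ℤ => ℂ) 2),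
      Memℓp (fun n => u n * (f : ℤ → ℂ) (e n)) 2 := by
    intro e u hu f
    rw [memℓp_gen_iff h2]
    have := (memℓp_gen_iff h2).1 (lp.memℓp f)
    simpa [hu, Function.comp_def] using (e.summable_iff.2 this)
  let L : lp (fun _ : ℤ => ℂ) 2 →ₗᵢ[ℂ] lp (fun _ : ℤ => ℂ) 2 :=
    { toFun := fun f => ⟨fun n => u n * (f : ℤ → ℂ) (e n), hmem e u hu f⟩
      map_add' := fun f g => by
        ext n
        exact mul_add _ _ _
      map_smul' := fun c f => by
        ext n
        simp [mul_left_comm]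
      norm_map' := fun f => by
        rw [lp.norm_eq_tsum_rpow h2, lp.norm_eq_tsum_rpow h2]
        congr 1
        rw [← e.tsum_eq (fun i => ‖(f : ℤ → ℂ) i‖ ^ (2 : ENNReal).toReal)]
        simp [hu] }
  have hL : ∀ f n, (L f : ℤ → ℂ) n = u n * (f : ℤ → ℂ) (e n) := fun f n => rfl
  have hu0 : ∀ n, u n ≠ 0 := fun n h => by have := hu n; simp [h] at this
  have hs : Function.Surjective L := by
    intro g
    refine ⟨⟨fun n => (u (e.symm n))⁻¹ * (g : ℤ → ℂ) (e.symm n),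
      hmem e.symm (fun n => (u (e.symm n))⁻¹) (fun n => by simp [hu]) g⟩, ?_⟩
    ext n
    rw [hL]
    simp [hu0]
  refine ⟨_, (Unitary.linearIsometryEquiv.symm (LinearIsometryEquiv.ofSurjective L hs)).2, ?_⟩
  intro f n
  exact hL f n

/-- The model on `ℓ²(ℤ)`. -/
theorem exists_model (b : OrthonormalBasis (Fin 2) ℂ (EuclideanSpace ℂ (Fin 2))) :
    ∃ (V : EuclideanSpace ℂ (Fin 2) →ₗᵢ[ℂ] lp (fun _ : ℤ => ℂ) 2)
      (M : Submodule ℂ (lp (fun _ : ℤ => ℂ) 2))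
      (S P : lp (fun _ : ℤ => ℂ) 2 →L[ℂ] lp (fun _ : ℤ => ℂ) 2)
      (N Z : EuclideanSpace ℂ (Fin 2) →L[ℂ] EuclideanSpace ℂ (Fin 2)),
      IsClosed (M : Set (lp (fun _ : ℤ => ℂ) 2)) ∧ S ∈ unitary _ ∧ P ∈ unitary _ ∧
      P * S = -(S * P) ∧ (∀ v, V v ∈ M) ∧
      DilRel M (ContinuousLinearMap.adjoint V.toContinuousLinearMap) S N ∧
      DilRel M (ContinuousLinearMap.adjoint V.toContinuousLinearMap) P Z ∧
      N (b 0) = 0 ∧ N (b 1) = b 0 ∧ Z (b 0) = -b 0 ∧ Z (b 1) = b 1 := by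
  have hon := orthonormal_iff_ite.1 b.orthonormal
  obtain ⟨S, hS, hS'⟩ := exists_weighted_perm (Equiv.subRight 1) (fun _ => 1) (by simp)
  obtain ⟨P, hP, hP'⟩ := exists_weighted_perm (Equiv.refl ℤ) (fun n => (-1) ^ n) (by simp)
  let L : EuclideanSpace ℂ (Fin 2) →ₗ[ℂ] lp (fun _ : ℤ => ℂ) 2 :=
    { toFun := fun v => lp.single 2 1 (inner ℂ (b 0) v) + lp.single 2 0 (inner ℂ (b 1) v)
      map_add' := fun v w => by
        simp only [inner_add_right, lp.single_add]; abel
      map_smul' := fun c v => by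
        simp only [inner_smul_right, ← smul_eq_mul, lp.single_smul, smul_add, RingHom.id_apply] }
  have hLi : ∀ v (f : lp (fun _ : ℤ => ℂ) 2), inner ℂ (L v) f =
      inner ℂ (inner ℂ (b 0) v) ((f : ℤ → ℂ) 1) + inner ℂ (inner ℂ (b 1) v) ((f : ℤ → ℂ) 0) := by
    intro v f
    show inner ℂ (lp.single 2 1 (inner ℂ (b 0) v) + lp.single 2 0 (inner ℂ (b 1) v)) f = _
    rw [inner_add_left, lp.inner_single_left, lp.inner_single_left]
  have hL1 : ∀ v, (L v : ℤ → ℂ) 1 = inner ℂ (b 0) v := fun v => by simp [L]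
  have hL0 : ∀ v, (L v : ℤ → ℂ) 0 = inner ℂ (b 1) v := fun v => by simp [L]
  have hLn : ∀ v (n : ℤ), n < 0 → (L v : ℤ → ℂ) n = 0 := fun v n hn => by
    have h1 : n ≠ 1 := by omega
    have h0 : n ≠ 0 := by omega
    simp [L, h1, h0]
  let V := L.isometryOfInner (fun v w => by
    rw [hLi, hL1, hL0, ← b.sum_inner_mul_inner v w]
    simp [Fin.sum_univ_two, mul_comm])
  have hV : ∀ v, V v = L v := fun v => rfl
  have hQ : ∀ f : lp (fun _ : ℤ => ℂ) 2,
      ContinuousLinearMap.adjoint V.toContinuousLinearMap f =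
        (f : ℤ → ℂ) 1 • b 0 + (f : ℤ → ℂ) 0 • b 1 := by
    intro f
    refine ext_inner_left ℂ fun v => ?_
    rw [ContinuousLinearMap.adjoint_inner_right]
    show inner ℂ (L v) f = _
    rw [hLi]
    simp [inner_add_right, inner_smul_right]
  let M : Submodule ℂ (lp (fun _ : ℤ => ℂ) 2) :=
    ⨅ (n : ℤ) (_ : n < 0), LinearMap.ker (lp.evalCLM ℂ (fun _ : ℤ => ℂ) 2 n).toLinearMap
  have hM : ∀ f, f ∈ M ↔ ∀ n : ℤ, n < 0 → (f : ℤ → ℂ) n = 0 := by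
    intro f
    simp only [M, Submodule.mem_iInf]
    rfl
  have hMc : IsClosed (M : Set (lp (fun _ : ℤ => ℂ) 2)) := by
    simp only [M, Submodule.coe_iInf]
    refine isClosed_iInter fun n => isClosed_iInter fun _ => ?_
    exact (lp.evalCLM ℂ (fun _ : ℤ => ℂ) 2 n).isClosed_ker
  refine ⟨V, M, S, P, (innerSL ℂ (b 1)).smulRight (b 0),
    (innerSL ℂ (b 1)).smulRight (b 1) - (innerSL ℂ (b 0)).smulRight (b 0),
    hMc, hS, hP, ?_, ?_, ?_, ?_, ?_, ?_, ?_, ?_⟩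
  · ext f n
    show (P (S f) : ℤ → ℂ) n = -(S (P f) : ℤ → ℂ) n
    rw [hP', hS', hS', hP']
    simp [zpow_sub_one₀]
  · intro v
    rw [hM]
    exact hLn v
  · intro f hf
    rw [hM] at hf
    refine ⟨(hM _).2 fun n hn => ?_, ?_⟩
    · rw [hS']
      simpa using hf (n - 1) (by omega)
    · rw [hQ, hQ, hS', hS']
      have := hf (-1) (by omega)
      simp [this, hon, inner_add_right, inner_smul_right]
  · intro f hf
    rw [hM] at hf
    refine ⟨(hM _).2 fun n hn => ?_, ?_⟩
    · rw [hP']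
      simp [hf n hn]
    · rw [hQ, hQ, hP', hP']
      simp [hon, inner_add_right, inner_smul_right]
      abel
  all_goals simp [hon]

/-- Types of the unitaries appearing in the dilation. -/
theorem exists_dilation {H K : Type} [NormedAddCommGroup K] [InnerProductSpace ℂ K]
    [CompleteSpace K] [NormedAddCommGroup H] [InnerProductSpace ℂ H]
    {M : Submodule ℂ K} {Q : K →L[ℂ] H} (hM : IsClosed (M : Set K)) {S P : K →L[ℂ] K}
    {N Z : H →L[ℂ] H} (hS : S ∈ unitary (K →L[ℂ] K))
    (hPS : P * S = -(S * P)) (hSN : DilRel M Q S N) (hPZ : DilRel M Q P Z) (hN : N * N = 0) :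
    (∀ c : ℂ, ‖c‖ ≤ 1 → ∃ U ∈ unitary (K →L[ℂ] K), DilRel M Q U (c • N) ∧
      (∀ C, Commute C S → Commute C U) ∧ P * U = -(U * P)) ∧
    (∀ w y : ℂ, ‖w‖ ≤ 1 → ‖y‖ ≤ 1 - ‖w‖ ^ 2 → ∃ G ∈ unitary (K →L[ℂ] K),
      DilRel M Q (G * P) ((w • 1 + y • N) * Z) ∧ (∀ C, Commute C S → Commute C G)) := by
  constructor
  · intro c hc
    obtain ⟨B, hB, hBC, hBr⟩ := exists_moebius (Q := Q) hM (S * S) (mul_mem hS hS) c hc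
    have hr := hBr 0 (by simp) (by have := hSN.mul hSN; rwa [hN] at this)
    refine ⟨S * B, mul_mem hS hB, ?_, ?_, ?_⟩
    · have := hSN.mul hr
      simpa using this
    · intro C hC
      exact hC.mul_right (hBC C (hC.mul_right hC))
    · have h1 : Commute P (S * S) := by
        show P * (S * S) = S * S * P
        rw [← mul_assoc, hPS, neg_mul, mul_assoc, hPS, mul_neg, neg_neg, mul_assoc]
      rw [← mul_assoc, hPS, neg_mul, mul_assoc, (hBC P h1).eq, mul_assoc]
  · intro w y hw hy
    rcases hw.lt_or_eq with hw' | hw'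
    · have hs : 0 < 1 - ‖w‖ ^ 2 := by nlinarith [norm_nonneg w]
      have hsc : (1 - starRingEnd ℂ w * w) = ((1 - ‖w‖ ^ 2 : ℝ) : ℂ) := by
        rw [RCLike.conj_mul]; simp
      have hs0 : ((1 - ‖w‖ ^ 2 : ℝ) : ℂ) ≠ 0 := by exact_mod_cast hs.ne'
      obtain ⟨B, hB, hBC, hBr⟩ := exists_moebius (Q := Q) hM S hS
        (y / ((1 - ‖w‖ ^ 2 : ℝ) : ℂ)) (by
          rw [norm_div, Complex.norm_real, Real.norm_of_nonneg hs.le]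
          exact (div_le_one hs).2 hy)
      set c := y / ((1 - ‖w‖ ^ 2 : ℝ) : ℂ) with hc
      have hr := hSN.mul (hBr N hN hSN)
      have hr' : DilRel M Q (S * B) (c • N) := by
        simpa [mul_add, hN] using hr
      obtain ⟨G, hG, hGC, hGr⟩ := exists_moebius (Q := Q) hM (S * B) (mul_mem hS hB) w hw
      have hr2 := hGr _ (by simp [hN]) hr'
      refine ⟨G, hG, ?_, fun C hC => hGC C (hC.mul_right (hBC C hC))⟩
      have := hr2.mul hPZ
      rwa [hsc, smul_smul, hc, mul_div_cancel₀ _ hs0] at this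
    · have hy0 : y = 0 := by
        rw [hw'] at hy
        have : ‖y‖ ≤ 0 := by simpa using hy
        simpa using this
      obtain ⟨G, hG, hGC, hGr⟩ := exists_moebius (Q := Q) hM S hS w hw
      refine ⟨G, hG, ?_, hGC⟩
      have hr := (hGr N hN hSN).mul hPZ
      have hz : 1 - starRingEnd ℂ w * w = 0 := by rw [RCLike.conj_mul, hw']; simp
      rw [hz] at hr
      simpa [hy0] using hr

/-- The contraction bound for a triangular trace-free operator. -/
theorem contraction_bound {H : Type} [NormedAddCommGroup H] [InnerProductSpace ℂ H]
    (b : OrthonormalBasis (Fin 2) ℂ H) (A : H →L[ℂ] H) (hA : ‖A‖ ≤ 1) (x y : ℂ)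
    (h0 : A (b 0) = x • b 0) (h1 : A (b 1) = y • b 0 - x • b 1) :
    ‖x‖ ≤ 1 ∧ ‖y‖ ≤ 1 - ‖x‖ ^ 2 := by
  have hn : ∀ p q : ℂ, ‖p • b 0 + q • b 1‖ ^ 2 = ‖p‖ ^ 2 + ‖q‖ ^ 2 := by
    intro p q
    rw [← b.sum_sq_norm_inner_right]
    have hon := orthonormal_iff_ite.1 b.orthonormal
    simp [Fin.sum_univ_two, inner_add_right, inner_smul_right, hon]
  have key : ∀ p q : ℂ, ‖x * p + y * q‖ ^ 2 + (‖x‖ * ‖q‖) ^ 2 ≤ ‖p‖ ^ 2 + ‖q‖ ^ 2 := by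
    intro p q
    have h2 : A (p • b 0 + q • b 1) = (x * p + y * q) • b 0 + (-(x * q)) • b 1 := by
      rw [map_add, map_smul, map_smul, h0, h1]; module
    have h3 : ‖A (p • b 0 + q • b 1)‖ ≤ ‖p • b 0 + q • b 1‖ := by
      simpa using A.le_of_opNorm_le hA (p • b 0 + q • b 1)
    have h4 := pow_le_pow_left₀ (norm_nonneg _) h3 2
    rw [h2, hn, hn, norm_neg, norm_mul] at h4
    exact h4
  have hx : ‖x‖ ≤ 1 := by
    have := key 1 0
    simp at this
    exact this
  refine ⟨hx, ?_⟩
  set s := 1 - ‖x‖ ^ 2 with hs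
  have hs0 : 0 ≤ s := by nlinarith [norm_nonneg x]
  rcases hs0.lt_or_eq with hsp | hsz
  · have h5 := key (starRingEnd ℂ x * y) (s : ℂ)
    have h6 : x * (starRingEnd ℂ x * y) + y * (s : ℂ) = y := by
      rw [← mul_assoc, Complex.mul_conj', hs]; push_cast; ring
    rw [h6, norm_mul, RCLike.norm_conj, Complex.norm_real, Real.norm_of_nonneg hs0] at h5
    have hxs : ‖x‖ ^ 2 = 1 - s := by rw [hs]; ring
    have h7 : s * ‖y‖ ^ 2 ≤ s * s ^ 2 := by
      rw [mul_pow, mul_pow, hxs] at h5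
      nlinarith
    exact le_of_sq_le_sq (le_of_mul_le_mul_left h7 hsp) hs0
  · have h5 := key 0 1
    simp at h5
    rw [← hsz]
    have : ‖y‖ ^ 2 ≤ 0 := by linarith
    nlinarith [norm_nonneg y]

theorem exists_adapted_basis (A : EuclideanSpace ℂ (Fin 2) →L[ℂ] EuclideanSpace ℂ (Fin 2))
    (hA : A ≠ 0) (hA2 : A ^ 2 = 0) :
    ∃ (b : OrthonormalBasis (Fin 2) ℂ (EuclideanSpace ℂ (Fin 2))) (p : ℂ),
      p ≠ 0 ∧ A (b 0) = 0 ∧ A (b 1) = p • b 0 := by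
  have hAA : ∀ v, A (A v) = 0 := fun v => by
    have := congrArg (fun L : EuclideanSpace ℂ (Fin 2) →L[ℂ] EuclideanSpace ℂ (Fin 2) => L v) hA2
    simpa [pow_two] using this
  obtain ⟨v, hv⟩ : ∃ v, A v ≠ 0 := by
    by_contra! h
    exact hA (ContinuousLinearMap.ext h)
  set e : EuclideanSpace ℂ (Fin 2) := ((‖A v‖⁻¹ : ℝ) : ℂ) • A v with he
  have hen : ‖e‖ = 1 := by
    rw [he, norm_smul, Complex.norm_real, norm_inv, norm_norm]
    exact inv_mul_cancel₀ (norm_ne_zero_iff.2 hv)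
  have hon : Orthonormal ℂ (({0} : Set (Fin 2)).domRestrict (fun _ : Fin 2 => e)) := by
    constructor
    · intro i; exact hen
    · intro i j hij
      exact absurd (Subsingleton.elim i j) hij
  obtain ⟨b, hb⟩ := hon.exists_orthonormalBasis_extension_of_card_eq (by simp)
  have hb0 : b 0 = e := hb 0 rfl
  have hb0A : A (b 0) = 0 := by rw [hb0, he, map_smul, hAA, smul_zero]
  have hexp : ∀ w, w = inner ℂ (b 0) w • b 0 + inner ℂ (b 1) w • b 1 := fun w => by
    have := b.sum_repr' w
    rw [Fin.sum_univ_two] at this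
    exact this.symm
  have hq : inner ℂ (b 1) (A (b 1)) = 0 ∨ A (b 1) = 0 := by
    have h1 := hAA (b 1)
    rw [hexp (A (b 1)), map_add, map_smul, map_smul, hb0A, smul_zero, zero_add] at h1
    exact smul_eq_zero.1 h1
  have hq' : inner ℂ (b 1) (A (b 1)) = 0 := by
    rcases hq with h | h
    · exact h
    · rw [h, inner_zero_right]
  have hA1 : A (b 1) = inner ℂ (b 0) (A (b 1)) • b 0 := by
    have := hexp (A (b 1))
    rwa [hq', zero_smul, add_zero] at this
  refine ⟨b, _, ?_, hb0A, hA1⟩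
  intro h0
  rw [h0, zero_smul] at hA1
  apply hv
  rw [hexp v, map_add, map_smul, map_smul, hb0A, hA1, smul_zero, smul_zero, add_zero]

theorem triangular_form {H : Type} [NormedAddCommGroup H] [InnerProductSpace ℂ H]
    (b : OrthonormalBasis (Fin 2) ℂ H) (A B : H →L[ℂ] H) (p : ℂ) (hp : p ≠ 0)
    (h0 : A (b 0) = 0) (h1 : A (b 1) = p • b 0) (hAB : A * B = -(B * A)) :
    ∃ x y : ℂ, B (b 0) = x • b 0 ∧ B (b 1) = y • b 0 - x • b 1 := by
  have hexp : ∀ w, w = inner ℂ (b 0) w • b 0 + inner ℂ (b 1) w • b 1 := fun w => by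
    have := b.sum_repr' w
    rw [Fin.sum_univ_two] at this
    exact this.symm
  have hAB' : ∀ v, A (B v) = -B (A v) := fun v =>
    congrArg (fun L : H →L[ℂ] H => L v) hAB
  have hb0 : b 0 ≠ 0 := b.orthonormal.ne_zero 0
  have h2 := hAB' (b 0)
  have e0 := hexp (B (b 0))
  have e1 := hexp (B (b 1))
  generalize (inner ℂ (b 0) (B (b 0)) : ℂ) = x at *
  generalize (inner ℂ (b 1) (B (b 0)) : ℂ) = z at *
  generalize (inner ℂ (b 0) (B (b 1)) : ℂ) = y at *
  generalize (inner ℂ (b 1) (B (b 1)) : ℂ) = w at *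
  have hz : z = 0 := by
    rw [e0, map_add, map_smul, map_smul, h0, h1, map_zero B, neg_zero, smul_zero, zero_add,
      smul_smul] at h2
    simpa [hp, hb0] using h2
  rw [hz, zero_smul, add_zero] at e0
  have h3 := hAB' (b 1)
  rw [e1, map_add, map_smul, map_smul, h0, h1, map_smul, e0, smul_zero, zero_add,
      smul_smul, smul_smul, ← neg_smul] at h3
  have h4 := smul_left_injective ℂ hb0 h3
  have hw : w = -x := by
    apply mul_right_cancel₀ hp
    linear_combination h4
  refine ⟨x, y, e0, ?_⟩
  rw [e1, hw]; module

/-- An anti-commuting tuple of contractions on `ℂ²` containing a non-zero nilpotent matrix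
admits a dilation to a `q̃`-commuting tuple of unitaries with `q̃ ⊆ {1, -1}`. -/
theorem stmt5 (k : ℕ) (T : Fin k → Matrix (Fin 2) (Fin 2) ℂ)
    (hcontr : ∀ i, opNorm2 (T i) ≤ 1)
    (hanti : ∀ i j : Fin k, i < j → T i * T j = -(T j * T i))
    (hnil : ∃ i, T i ≠ 0 ∧ (T i) ^ 2 = 0) :
    ∃ (K : Type) (_ : NormedAddCommGroup K) (_ : InnerProductSpace ℂ K) (_ : CompleteSpace K)
      (qt : Fin k → Fin k → ℂ) (U : Fin k → K →L[ℂ] K)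
      (V : EuclideanSpace ℂ (Fin 2) →ₗᵢ[ℂ] K),
      (∀ i j : Fin k, i < j → (qt i j = 1 ∨ qt i j = -1)) ∧
      (∀ i, U i ∈ unitary (K →L[ℂ] K)) ∧
      (∀ i j : Fin k, i < j → U i * U j = qt i j • (U j * U i)) ∧
      (∀ m : Fin k → ℕ,
        Matrix.toEuclideanCLM (𝕜 := ℂ) (((List.finRange k).map (fun i => T i ^ m i)).prod) =
          (ContinuousLinearMap.adjoint V.toContinuousLinearMap) ∘L
            (((List.finRange k).map (fun i => U i ^ m i)).prod) ∘L V.toContinuousLinearMap) := by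
  classical
  obtain ⟨p, hp0, hp2⟩ := hnil
  let A : Fin k → (EuclideanSpace ℂ (Fin 2) →L[ℂ] EuclideanSpace ℂ (Fin 2)) :=
    fun i => Matrix.toEuclideanCLM (𝕜 := ℂ) (T i)
  have hAc : ∀ i, ‖A i‖ ≤ 1 := hcontr
  have hAanti' : ∀ i j, i < j → A i * A j = -(A j * A i) := fun i j hij => by
    simp only [A, ← map_mul, hanti i j hij, map_neg]
  have hAanti : ∀ i j, i ≠ j → A i * A j = -(A j * A i) := fun i j hij => by
    rcases lt_or_gt_of_ne hij with h | h
    · exact hAanti' i j h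
    · rw [hAanti' j i h, neg_neg]
  have hAp2 : A p ^ 2 = 0 := by simp only [A, ← map_pow, hp2, map_zero]
  have hAp0 : A p ≠ 0 := fun h => hp0 (by
    simpa [A] using h)
  obtain ⟨b, a, ha, hb0, hb1⟩ := exists_adapted_basis (A p) hAp0 hAp2
  have htri : ∀ i, ∃ x y : ℂ, A i (b 0) = x • b 0 ∧ A i (b 1) = y • b 0 - x • b 1 := by
    intro i
    refine triangular_form b (A p) (A i) a ha hb0 hb1 ?_
    by_cases hip : p = i
    · subst hip
      rw [← pow_two, hAp2, neg_zero]
    · exact hAanti p i hip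
  choose x y hx hy using htri
  have hxx : ∀ i j, i ≠ j → x i = 0 ∨ x j = 0 := by
    intro i j hij
    have h1 : A i (A j (b 1)) = -A j (A i (b 1)) :=
      congrArg (fun L : EuclideanSpace ℂ (Fin 2) →L[ℂ] EuclideanSpace ℂ (Fin 2) => L (b 1))
        (hAanti i j hij)
    rw [hy, hy, map_sub, map_sub, map_smul, map_smul, map_smul, map_smul, hx, hx, hy, hy] at h1
    have h2 := congrArg (fun v => inner ℂ (b 1) v) h1
    have hon := orthonormal_iff_ite.1 b.orthonormal
    simp [inner_sub_right, inner_smul_right, hon] at h2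
    have h3 : x i * x j = 0 := by linear_combination h2 / 2
    exact mul_eq_zero.1 h3
  have hbd := fun i => contraction_bound b (A i) (hAc i) (x i) (y i) (hx i) (hy i)
  obtain ⟨V, M, S, P, N, Z, hMc, hS, hP, hPS, hVM, hSN, hPZ, hN0, hN1, hZ0, hZ1⟩ := exists_model b
  have hext : ∀ L L' : EuclideanSpace ℂ (Fin 2) →L[ℂ] EuclideanSpace ℂ (Fin 2),
      L (b 0) = L' (b 0) → L (b 1) = L' (b 1) → L = L' := by
    intro L L' h0 h1
    apply ContinuousLinearMap.coe_injective
    refine b.toBasis.ext fun i => ?_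
    fin_cases i
    · simpa using h0
    · simpa using h1
  have hNN : N * N = 0 := by
    apply hext
    · simp [hN0]
    · simp [hN0, hN1]
  obtain ⟨hodd, hev⟩ := exists_dilation hMc hS hPS hSN hPZ hNN
  have hU : ∀ i, ∃ U ∈ unitary (lp (fun _ : ℤ => ℂ) 2 →L[ℂ] lp (fun _ : ℤ => ℂ) 2),
      DilRel M (ContinuousLinearMap.adjoint V.toContinuousLinearMap) U (A i) ∧
      (x i = 0 → (∀ C, Commute C S → Commute C U) ∧ P * U = -(U * P)) ∧
      (x i ≠ 0 → ∃ G, U = G * P ∧ (∀ C, Commute C S → Commute C G)) := by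
    intro i
    by_cases hxi : x i = 0
    · have hyb := (hbd i).2
      obtain ⟨U, hU, hr, h1, h2⟩ := hodd (y i) (by simpa [hxi] using hyb)
      refine ⟨U, hU, ?_, fun _ => ⟨h1, h2⟩, fun h => absurd hxi h⟩
      convert hr using 1
      apply hext
      · simp [hx, hxi, hN0]
      · simp [hy, hxi, hN1]
    · obtain ⟨G, hG, hr, h1⟩ := hev (-x i) (y i) (by simpa using (hbd i).1)
        (by simpa using (hbd i).2)
      refine ⟨G * P, mul_mem hG hP, ?_, fun h => absurd h hxi, fun _ => ⟨G, rfl, h1⟩⟩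
      convert hr using 1
      apply hext
      · simp [hx, hN0, hZ0]
      · simp [hy, hN1, hZ1]
        abel
  choose U hUu hUr hUo hUe using hU
  have hmix : ∀ i j, x i = 0 → x j ≠ 0 → U i * U j = -(U j * U i) := by
    intro i j hi hj
    obtain ⟨h1, h2⟩ := hUo i hi
    obtain ⟨G, hG, h3⟩ := hUe j hj
    have h4 : Commute (U i) G := h3 _ (h1 S (Commute.refl S)).symm
    rw [hG, mul_assoc, h2, mul_neg, neg_neg, ← mul_assoc, ← mul_assoc, h4.eq]
  refine ⟨lp (fun _ : ℤ => ℂ) 2, inferInstance, inferInstance, inferInstance,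
    fun i j => if x i = 0 ∧ x j = 0 then 1 else -1, U, V, ?_, hUu, ?_, ?_⟩
  · intro i j _
    dsimp only
    split_ifs
    · exact Or.inl rfl
    · exact Or.inr rfl
  · intro i j hij
    by_cases hi : x i = 0
    · by_cases hj : x j = 0
      · have h1 := (hUo i hi).1 S (Commute.refl S)
        have h2 := (hUo j hj).1 (U i) h1.symm
        simp [hi, hj, h2.eq]
      · simp [hj, hmix i j hi hj]
    · have hj : x j = 0 := (hxx i j hij.ne).resolve_left hi
      simp [hi, hmix j i hj hi]
  · intro m
    have h1 := DilRel.list_prod (List.finRange k) (fun i => (hUr i).pow (m i))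
    have h2 : Matrix.toEuclideanCLM (𝕜 := ℂ) (((List.finRange k).map (fun i => T i ^ m i)).prod) =
        ((List.finRange k).map (fun i => A i ^ m i)).prod := by
      rw [map_list_prod, List.map_map]
      congr 1
      refine List.map_congr_left fun i _ => ?_
      simp [A]
    rw [h2]
    ext1 v
    have h3 := (h1 (V v) (hVM v)).2
    have h4 : ContinuousLinearMap.adjoint V.toContinuousLinearMap (V v) = v := by
      refine ext_inner_left ℂ fun w => ?_
      rw [ContinuousLinearMap.adjoint_inner_right]
      exact V.inner_map_map w v
    rw [h4] at h3
    exact h3.symm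
end

section
/- Let (T₁,…,T_k) be an anti-commuting tuple of contractions on ℂ² such that at least one T_i is non-zero and non-invertible. Then there exist a complex Hilbert space K, scalars q̃_{ij} ∈ {1,−1} (1 ≤ i < j ≤ k), unitary operators U₁,…,U_k on K with U_iU_j = q̃_{ij}U_jU_i for all i < j, and a linear isometry V : ℂ² → K such that T₁^{m₁}⋯T_k^{m_k} = V* U₁^{m₁}⋯U_k^{m_k} V for all nonnegative integers m₁,…,m_k. -/
section Helpers

set_option linter.unusedSectionVars false

open Matrix ContinuousLinearMap

/-- Abbreviation for the Hilbert space `ℂ²`. -/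
abbrev H2 := EuclideanSpace ℂ (Fin 2)

/-- Abbreviation for `2 × 2` complex matrices. -/
abbrev M2 := Matrix (Fin 2) (Fin 2) ℂ

section Abstract

variable {K : Type} [NormedAddCommGroup K] [InnerProductSpace ℂ K] [CompleteSpace K]

/-- `X` leaves `M` invariant and is a co-extension of `A` there. -/
def Co (Vd : K →L[ℂ] H2) (M : Submodule ℂ K) (X : K →L[ℂ] K) (A : M2) : Prop :=
  ∀ k ∈ M, X k ∈ M ∧ Vd (X k) = Matrix.toEuclideanCLM (𝕜 := ℂ) A (Vd k)

variable {Vd : K →L[ℂ] H2} {M : Submodule ℂ K}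

theorem Co.one : Co Vd M 1 1 := fun k hk => ⟨hk, by simp⟩

theorem Co.mul {X Y : K →L[ℂ] K} {A B : M2} (h1 : Co Vd M X A) (h2 : Co Vd M Y B) :
    Co Vd M (X * Y) (A * B) := by
  intro k hk
  have h3 := h2 k hk
  have h4 := h1 _ h3.1
  refine ⟨h4.1, ?_⟩
  rw [map_mul, mul_apply_eq_comp, mul_apply_eq_comp, h4.2, h3.2]

theorem Co.add {X Y : K →L[ℂ] K} {A B : M2} (h1 : Co Vd M X A) (h2 : Co Vd M Y B) :
    Co Vd M (X + Y) (A + B) := by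
  intro k hk
  refine ⟨M.add_mem (h1 k hk).1 (h2 k hk).1, ?_⟩
  rw [map_add, _root_.add_apply, _root_.add_apply, map_add,
    (h1 k hk).2, (h2 k hk).2]

theorem Co.smul {X : K →L[ℂ] K} {A : M2} (c : ℂ) (h1 : Co Vd M X A) :
    Co Vd M (c • X) (c • A) := by
  intro k hk
  refine ⟨M.smul_mem c (h1 k hk).1, ?_⟩
  rw [map_smul, _root_.smul_apply, _root_.smul_apply, map_smul,
    (h1 k hk).2]

theorem Co.pow {X : K →L[ℂ] K} {A : M2} (h1 : Co Vd M X A) (n : ℕ) :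
    Co Vd M (X ^ n) (A ^ n) := by
  induction n with
  | zero => simpa using Co.one
  | succ n ih => rw [pow_succ, pow_succ]; exact ih.mul h1

theorem Co.list {k : ℕ} {X : Fin k → K →L[ℂ] K} {A : Fin k → M2} (h : ∀ i, Co Vd M (X i) (A i))
    (m : Fin k → ℕ) (l : List (Fin k)) :
    Co Vd M ((l.map (fun i => X i ^ m i)).prod) ((l.map (fun i => A i ^ m i)).prod) := by
  induction l with
  | nil => simpa using Co.one
  | cons a l ih =>
    simp only [List.map_cons, List.prod_cons]
    exact ((h a).pow _).mul ih

/-- Moebius transform of a unitary. -/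
theorem mob (hM : IsClosed (M : Set K)) {X : K →L[ℂ] K} (hX : X ∈ unitary (K →L[ℂ] K))
    (y : ℂ) (hy : ‖y‖ ≤ 1) :
    ∃ X' ∈ unitary (K →L[ℂ] K), (∀ Y, Commute X Y → Commute X' Y) ∧
      ∀ A L : M2, Co Vd M X A → L * (1 + star y • A) = 1 →
        Co Vd M X' (L * (A + y • 1)) := by
  rcases eq_or_lt_of_le hy with h1 | h1
  · have hyy : y * star y = 1 := by
      rw [Complex.star_def, Complex.mul_conj, Complex.normSq_eq_norm_sq, h1]; simp
    have hyy' : star y * y = 1 := by rw [mul_comm]; exact hyy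
    refine ⟨y • 1, ?_, ?_, ?_⟩
    · rw [Unitary.mem_iff]
      constructor
      · rw [star_smul, star_one, smul_mul_smul_comm, hyy']; simp
      · rw [star_smul, star_one, smul_mul_smul_comm, hyy]; simp
    · intro Y _
      exact (Commute.one_left Y).smul_left y
    · intro A L _ hL
      have : L * (A + y • 1) = y • 1 := by
        have h2 : A + y • 1 = y • (1 + star y • A) := by
          rw [smul_add, smul_smul, hyy, one_smul, add_comm]
        rw [h2, mul_smul_comm, hL]
      rw [this]
      exact Co.one.smul y
  · have hXn : ‖X‖ ≤ 1 := by
      refine X.opNorm_le_bound zero_le_one fun k => ?_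
      have : ‖X k‖ = ‖k‖ := ContinuousLinearMap.norm_map_of_mem_unitary hX k
      rw [this]; simp
    set x : K →L[ℂ] K := -(star y • X) with hx
    have hxn : ‖x‖ < 1 := by
      rw [hx, norm_neg, norm_smul, norm_star]
      calc ‖y‖ * ‖X‖ ≤ ‖y‖ * 1 := by gcongr
        _ < 1 := by simpa using h1
    set a : K →L[ℂ] K := 1 + star y • X with ha
    have hax : a = 1 - x := by rw [ha, hx, sub_neg_eq_add]
    set J : K →L[ℂ] K := ∑' i : ℕ, x ^ i with hJ
    have hJa : J * a = 1 := by rw [hax]; exact geom_series_mul_neg x hxn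
    have haJ : a * J = 1 := by rw [hax]; exact mul_neg_geom_series x hxn
    have hcommJ : ∀ Y, Commute a Y → Commute J Y := by
      intro Y h
      change J * Y = Y * J
      calc J * Y = J * (Y * (a * J)) := by rw [haJ, mul_one]
        _ = J * (Y * a) * J := by simp only [mul_assoc]
        _ = J * (a * Y) * J := by rw [h.eq]
        _ = (J * a) * Y * J := by simp only [mul_assoc]
        _ = Y * J := by rw [hJa, one_mul]
    set b : K →L[ℂ] K := X + y • 1 with hb
    have hX1 : star X * X = 1 := (Unitary.mem_iff.1 hX).1
    have hX2 : X * star X = 1 := (Unitary.mem_iff.1 hX).2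
    have hab : Commute a b := by
      change a * b = b * a
      simp only [ha, hb, mul_add, add_mul, one_mul, mul_one, smul_mul_assoc, mul_smul_comm]
      module
    have hJb : J * b = b * J := hcommJ b hab
    have h2 : star b * b = star a * a := by
      simp only [ha, hb, star_add, star_smul, star_one, star_star, mul_add, add_mul, one_mul,
        mul_one, smul_mul_assoc, mul_smul_comm, hX1]
      module
    have h3 : b * star b = a * star a := by
      simp only [ha, hb, star_add, star_smul, star_one, star_star, mul_add, add_mul, one_mul,
        mul_one, smul_mul_assoc, mul_smul_comm, hX2]
      module
    have hJM : ∀ k ∈ M, (∀ k ∈ M, X k ∈ M) → J k ∈ M := by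
      intro k hk hXM
      have hs : HasSum (fun i : ℕ => x ^ i) J := (summable_geometric_of_norm_lt_one hxn).hasSum
      have hs2 : HasSum (fun i : ℕ => (x ^ i) k) (J k) :=
        hs.mapL (ContinuousLinearMap.apply ℂ K k)
      have hmem : ∀ i : ℕ, (x ^ i) k ∈ M := by
        intro i
        induction i with
        | zero => simpa using hk
        | succ i ih =>
          rw [pow_succ', mul_apply_eq_comp, hx]
          exact M.neg_mem (M.smul_mem _ (hXM _ ih))
      exact hM.mem_of_tendsto hs2 (Filter.Eventually.of_forall fun s =>
        M.sum_mem fun i _ => hmem i)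
    refine ⟨J * b, ?_, ?_, ?_⟩
    · rw [Unitary.mem_iff]
      constructor
      · rw [hJb, star_mul]
        calc star J * star b * (b * J) = star J * (star b * b) * J := by simp only [mul_assoc]
          _ = star (a * J) * (a * J) := by rw [h2, star_mul]; simp only [mul_assoc]
          _ = 1 := by rw [haJ]; simp
      · rw [star_mul]
        calc J * b * (star b * star J) = J * (b * star b) * star J := by simp only [mul_assoc]
          _ = (J * a) * star (J * a) := by rw [h3, star_mul]; simp only [mul_assoc]
          _ = 1 := by rw [hJa]; simp
    · intro Y hY
      have h5 : Commute a Y := (Commute.one_left Y).add_left (hY.smul_left _)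
      have h6 : Commute b Y := hY.add_left ((Commute.one_left Y).smul_left _)
      exact (hcommJ Y h5).mul_left h6
    · intro A L hA hL k hk
      have hbco : Co Vd M b (A + y • 1) := hA.add (Co.one.smul y)
      have haco : Co Vd M a (1 + star y • A) := Co.one.add (hA.smul _)
      have hmem : (J * b) k ∈ M := hJM _ (hbco k hk).1 fun k hk => (hA k hk).1
      refine ⟨hmem, ?_⟩
      have h7 := (haco _ hmem).2
      rw [← mul_apply_eq_comp, ← mul_assoc, haJ, one_mul, (hbco k hk).2] at h7
      have h8 := congrArg (Matrix.toEuclideanCLM (𝕜 := ℂ) L) h7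
      rw [← mul_apply_eq_comp, ← mul_apply_eq_comp, ← map_mul, ← map_mul,
        hL, map_one] at h8
      exact h8.symm

/-- The scalar case of the Moebius transform. -/
theorem mob0 (hM : IsClosed (M : Set K)) {X : K →L[ℂ] K} (hX : X ∈ unitary (K →L[ℂ] K))
    (hX0 : Co Vd M X 0) (y : ℂ) (hy : ‖y‖ ≤ 1) :
    ∃ X' ∈ unitary (K →L[ℂ] K), (∀ Y, Commute X Y → Commute X' Y) ∧ Co Vd M X' (y • 1) := by
  obtain ⟨X', h1, h2, h3⟩ := mob (Vd := Vd) hM hX y hy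
  refine ⟨X', h1, h2, ?_⟩
  simpa using h3 0 1 hX0 (by simp)

/-- The tuple `T` has a good coextension. -/
def Good (Vd : K →L[ℂ] H2) (M : Submodule ℂ K) {k : ℕ} (T : Fin k → M2) : Prop :=
  ∃ (qt : Fin k → Fin k → ℂ) (U : Fin k → K →L[ℂ] K),
    (∀ i j : Fin k, i < j → (qt i j = 1 ∨ qt i j = -1)) ∧
    (∀ i, U i ∈ unitary (K →L[ℂ] K)) ∧
    (∀ i j : Fin k, i < j → U i * U j = qt i j • (U j * U i)) ∧
    (∀ i, Co Vd M (U i) (T i))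

/-- A unitary matrix lifted to the big space. -/
theorem lift (V : H2 →ₗᵢ[ℂ] K) (hV : ∀ f, V f ∈ M) {g : M2} (hg : g ∈ unitary M2) :
    ∃ G ∈ unitary (K →L[ℂ] K), Co (adjoint V.toContinuousLinearMap) M G g ∧
      Co (adjoint V.toContinuousLinearMap) M (star G) (star g) := by
  set v := V.toContinuousLinearMap with hv
  have hvv : ∀ x, adjoint v (v x) = x := by
    intro x
    refine ext_inner_left ℂ fun w => ?_
    rw [adjoint_inner_right]
    exact V.inner_map_map w x
  set D : M2 → K →L[ℂ] K := fun g => 1 + v ∘L (Matrix.toEuclideanCLM (𝕜 := ℂ) (g - 1)) ∘L adjoint v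
    with hD
  have hmul : ∀ g h, D g * D h = D (g * h) := by
    intro g h
    ext k
    simp only [hD, mul_apply_eq_comp, _root_.add_apply,
      ContinuousLinearMap.comp_apply, one_apply_eq_self, map_add, hvv, map_sub, map_mul,
      map_one, _root_.sub_apply]
    abel
  have hone : D 1 = 1 := by simp [hD]
  have hstar : ∀ g, star (D g) = D (star g) := by
    intro g
    have : star (g - 1) = star g - 1 := by simp
    simp only [hD]
    rw [star_add, star_one, ← this, map_star, ContinuousLinearMap.star_eq_adjoint,
      ContinuousLinearMap.star_eq_adjoint, adjoint_comp, adjoint_comp, adjoint_adjoint]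
    rfl
  have hco : ∀ g, Co (adjoint v) M (D g) g := by
    intro g k hk
    refine ⟨M.add_mem hk (hV _), ?_⟩
    simp only [hD, _root_.add_apply, ContinuousLinearMap.comp_apply,
      one_apply_eq_self, map_add, hvv, map_sub, map_one, _root_.sub_apply]
    abel
  rw [Unitary.mem_iff] at hg
  refine ⟨D g, ?_, hco g, ?_⟩
  · rw [Unitary.mem_iff, hstar, hmul, hmul, hg.1, hg.2, hone]; simp
  · rw [hstar]; exact hco _

theorem Good.conj {V : H2 →ₗᵢ[ℂ] K} (hV : ∀ f, V f ∈ M) {g : M2} (hg : g ∈ unitary M2)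
    {k : ℕ} {T : Fin k → M2}
    (h : Good (adjoint V.toContinuousLinearMap) M (fun i => g * T i * star g)) :
    Good (adjoint V.toContinuousLinearMap) M T := by
  obtain ⟨G, hG, hG1, hG2⟩ := lift V hV hg
  obtain ⟨qt, U, h1, h2, h3, h4⟩ := h
  have hGG := Unitary.mem_iff.1 hG
  rw [Unitary.mem_iff] at hg
  have hprod : ∀ a b : K →L[ℂ] K, (star G * a * G) * (star G * b * G) = star G * (a * b) * G := by
    intro a b
    calc (star G * a * G) * (star G * b * G) = star G * a * (G * star G) * b * G := by
          simp only [mul_assoc]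
      _ = _ := by rw [hGG.2, mul_one]; simp only [mul_assoc]
  refine ⟨qt, fun i => star G * U i * G, h1, fun i => ?_, fun i j hij => ?_, fun i => ?_⟩
  · exact mul_mem (mul_mem (Unitary.star_mem hG) (h2 i)) hG
  · simp only [hprod]
    rw [h3 i j hij, mul_smul_comm, smul_mul_assoc]
  · have := (hG2.mul (h4 i)).mul hG1
    have e : star g * (g * T i * star g) * g = T i := by
      calc star g * (g * T i * star g) * g = (star g * g) * T i * (star g * g) := by
            simp only [mul_assoc]
        _ = T i := by rw [hg.1]; simp
    rwa [e] at this

theorem Good.dilate {V : H2 →ₗᵢ[ℂ] K} (hV : ∀ f, V f ∈ M) {k : ℕ} {T : Fin k → M2}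
    (h : Good (adjoint V.toContinuousLinearMap) M T) :
    ∃ (K : Type) (_ : NormedAddCommGroup K) (_ : InnerProductSpace ℂ K) (_ : CompleteSpace K)
      (qt : Fin k → Fin k → ℂ) (U : Fin k → K →L[ℂ] K)
      (V : EuclideanSpace ℂ (Fin 2) →ₗᵢ[ℂ] K),
      (∀ i j : Fin k, i < j → (qt i j = 1 ∨ qt i j = -1)) ∧
      (∀ i, U i ∈ unitary (K →L[ℂ] K)) ∧
      (∀ i j : Fin k, i < j → U i * U j = qt i j • (U j * U i)) ∧
      (∀ m : Fin k → ℕ,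
        Matrix.toEuclideanCLM (𝕜 := ℂ) (((List.finRange k).map (fun i => T i ^ m i)).prod) =
          (ContinuousLinearMap.adjoint V.toContinuousLinearMap) ∘L
            (((List.finRange k).map (fun i => U i ^ m i)).prod) ∘L V.toContinuousLinearMap) := by
  obtain ⟨qt, U, h1, h2, h3, h4⟩ := h
  refine ⟨K, _, _, inferInstance, qt, U, V, h1, h2, h3, fun m => ?_⟩
  refine ContinuousLinearMap.ext fun x => ?_
  have h5 := (Co.list h4 m (List.finRange k) (V x) (hV x)).2
  have hvv : adjoint V.toContinuousLinearMap (V x) = x := by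
    refine ext_inner_left ℂ fun w => ?_
    rw [adjoint_inner_right]
    exact V.inner_map_map w x
  rw [hvv] at h5
  exact h5.symm

/-- Case B. -/
theorem caseB (hM : IsClosed (M : Set K)) {X Y : K →L[ℂ] K} (hX : X ∈ unitary (K →L[ℂ] K))
    (hY : Y ∈ unitary (K →L[ℂ] K)) (hXY : Commute X Y) {A B : M2} (hA : Co Vd M X A)
    (hB : Co Vd M Y B) (hAB : A * B = 0) {k : ℕ} (T : Fin k → M2)
    (hT : ∀ i, ∃ y : ℂ, ‖y‖ ≤ 1 ∧ (T i = y • A ∨ T i = y • B)) : Good Vd M T := by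
  have hZ : X * Y ∈ unitary (K →L[ℂ] K) := mul_mem hX hY
  have hZ0 : Co Vd M (X * Y) 0 := by rw [← hAB]; exact hA.mul hB
  have hZX : Commute (X * Y) X := (Commute.refl X).mul_left hXY.symm
  have hZY : Commute (X * Y) Y := hXY.mul_left (Commute.refl Y)
  have key : ∀ i, ∃ D ∈ unitary (K →L[ℂ] K), ∃ W ∈ unitary (K →L[ℂ] K),
      (∀ C, Commute (X * Y) C → Commute D C) ∧
      (W = X ∨ W = Y) ∧ Co Vd M (D * W) (T i) := by
    intro i
    obtain ⟨y, hy, h⟩ := hT i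
    obtain ⟨D, hD, hD1, hD2⟩ := mob0 hM hZ hZ0 y hy
    rcases h with h | h
    · refine ⟨D, hD, X, hX, hD1, Or.inl rfl, ?_⟩
      have := hD2.mul hA
      rw [h]; simpa using this
    · refine ⟨D, hD, Y, hY, hD1, Or.inr rfl, ?_⟩
      have := hD2.mul hB
      rw [h]; simpa using this
  choose D hD W hW hDc hWc hco using key
  refine ⟨fun _ _ => 1, fun i => D i * W i, fun _ _ _ => Or.inl rfl,
    fun i => mul_mem (hD i) (hW i), fun i j _ => ?_, hco⟩
  have hZW : ∀ i, Commute (X * Y) (W i) := by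
    intro i
    rcases hWc i with h | h <;> rw [h] <;> assumption
  have hWW : Commute (W i) (W j) := by
    rcases hWc i with h | h <;> rcases hWc j with h' | h' <;> rw [h, h']
    · exact hXY
    · exact hXY.symm
  have hDD : Commute (D i) (D j) := hDc i _ (hDc j _ (Commute.refl _)).symm
  have h1 : Commute (D i) (W j) := hDc i _ (hZW j)
  have h2 : Commute (W i) (D j) := (hDc j _ (hZW i)).symm
  rw [one_smul]
  exact ((hDD.mul_right h1).mul_left (h2.mul_right hWW)).eq

/-- Case A. -/
theorem caseA (hM : IsClosed (M : Set K)) {S R : K →L[ℂ] K} (hS : S ∈ unitary (K →L[ℂ] K))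
    (hR : R ∈ unitary (K →L[ℂ] K)) (hSR : S * R = -(R * S))
    (hE : Co Vd M S !![0, 0; 1, 0]) (hJ : Co Vd M R !![1, 0; 0, -1]) {k : ℕ} (T : Fin k → M2)
    (j0 : Fin k) (p q : Fin k → ℂ) (hT : ∀ i, T i = !![-(p i), 0; q i, p i])
    (hp : ∀ i, i ≠ j0 → p i = 0) (hq : ∀ i, ‖q i‖ ≤ 1 - ‖p i‖ ^ 2) : Good Vd M T := by
  have hZ : S * S ∈ unitary (K →L[ℂ] K) := mul_mem hS hS
  have hZ0 : Co Vd M (S * S) 0 := by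
    have := hE.mul hE
    have e : (!![0, 0; 1, 0] : M2) * !![0, 0; 1, 0] = 0 := by
      ext i j; fin_cases i <;> fin_cases j <;> simp
    rwa [e] at this
  have hZS : Commute (S * S) S := (Commute.refl S).mul_left (Commute.refl S)
  have hZR : Commute (S * S) R := by
    change S * S * R = R * (S * S)
    rw [mul_assoc, hSR, mul_neg, ← mul_assoc, hSR, neg_mul, neg_neg, mul_assoc]
  have hp1 : ‖p j0‖ ≤ 1 := by
    have h1 := hq j0
    have h2 := norm_nonneg (q j0)
    have h3 := norm_nonneg (p j0)
    nlinarith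
  have hq1 : ∀ i, ‖q i‖ ≤ 1 := fun i => (hq i).trans (by nlinarith [norm_nonneg (p i)])
  set t : ℂ := q j0 / (1 - p j0 * star (p j0)) with ht
  have hpp : (1 : ℂ) - p j0 * star (p j0) = ((1 - ‖p j0‖ ^ 2 : ℝ) : ℂ) := by
    rw [Complex.star_def, Complex.mul_conj, Complex.normSq_eq_norm_sq]; push_cast; rfl
  have htq : (1 - p j0 * star (p j0)) * t = q j0 := by
    by_cases h0 : (1 : ℂ) - p j0 * star (p j0) = 0
    · rw [h0, zero_mul]
      have h1 := hq j0
      rw [hpp] at h0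
      have h2 : 1 - ‖p j0‖ ^ 2 = 0 := by exact_mod_cast h0
      rw [h2] at h1
      exact (norm_le_zero_iff.1 h1).symm
    · rw [ht]; field_simp
  have ht1 : ‖t‖ ≤ 1 := by
    rw [ht, norm_div, hpp, Complex.norm_real, Real.norm_eq_abs]
    exact div_le_one_of_le₀ ((hq j0).trans (le_abs_self _)) (abs_nonneg _)
  obtain ⟨D0, hD0, hD0c, hD0co⟩ := mob0 hM hZ hZ0 t ht1
  have hD0S : Commute D0 S := hD0c _ hZS
  obtain ⟨P, hP, hPc, hPco⟩ := mob (Vd := Vd) hM (mul_mem hD0 hS) (-(p j0)) (by simpa using hp1)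
  choose D hD hDc hDco using fun i => mob0 hM hZ hZ0 (q i) (hq1 i)
  have hDS : ∀ i, Commute (D i) S := fun i => hDc i _ hZS
  have hDR : ∀ i, Commute (D i) R := fun i => hDc i _ hZR
  have hDD : ∀ i j, Commute (D i) (D j) := fun i j => hDc i _ (hDc j _ (Commute.refl _)).symm
  have hDD0 : ∀ i, Commute (D i) D0 := fun i => hDc i _ (hD0c _ (Commute.refl _)).symm
  have hPS : Commute P S := hPc _ (hD0S.mul_left (Commute.refl S))
  have hPD : ∀ i, Commute P (D i) := fun i => hPc _ ((hDD0 i).symm.mul_left (hDS i).symm)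
  have hPR0 : Co Vd M (P * R) (T j0) := by
    have h1 := hPco (t • !![0, 0; 1, 0]) (1 + (star (p j0) * t) • !![0, 0; 1, 0])
      (by simpa using hD0co.mul hE)
      (by ext i j; fin_cases i <;> fin_cases j <;> simp [Matrix.mul_apply, Fin.sum_univ_two])
    have h2 := h1.mul hJ
    convert h2 using 1
    rw [hT, ← htq]
    ext i j; fin_cases i <;> fin_cases j <;> simp [Matrix.mul_apply, Fin.sum_univ_two]
    ring
  set U : Fin k → K →L[ℂ] K := fun i => if i = j0 then P * R else D i * S with hU
  have hanti : ∀ i, (D i * S) * (P * R) = -((P * R) * (D i * S)) := by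
    intro i
    calc (D i * S) * (P * R) = (D i * S * P) * R := by simp only [mul_assoc]
      _ = (P * (D i * S)) * R := by
        rw [((hPD i).symm.mul_left hPS.symm).eq]
      _ = P * (D i * (S * R)) := by simp only [mul_assoc]
      _ = -(P * (D i * R * S)) := by rw [hSR]; simp only [mul_neg, mul_assoc]
      _ = _ := by rw [(hDR i).eq]; simp only [mul_assoc]
  refine ⟨fun i j => if i = j0 ∨ j = j0 then -1 else 1, U, ?_, ?_, ?_, ?_⟩
  · intro i j _
    by_cases h : i = j0 ∨ j = j0
    · right; simp [h]
    · left; simp [h]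
  · intro i
    by_cases h : i = j0
    · simp only [hU, h, if_true]; exact mul_mem hP hR
    · simp only [hU, h, if_false]; exact mul_mem (hD i) hS
  · intro i j hij
    by_cases h : i = j0
    · have h' : j ≠ j0 := fun h' => by rw [h, h'] at hij; exact lt_irrefl _ hij
      simp only [hU, h, h', if_true, if_false, true_or]
      rw [hanti]; simp
    · by_cases h' : j = j0
      · simp only [hU, h, h', if_true, if_false, or_true]
        rw [hanti]; simp
      · simp only [hU, h, h', if_false, or_self, one_smul]
        exact (((hDD i j).mul_right (hDS i)).mul_left
          ((hDS j).symm.mul_right (Commute.refl S))).eq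
  · intro i
    by_cases h : i = j0
    · simp only [hU, h, if_true]; exact hPR0
    · simp only [hU, h, if_false]
      have := (hDco i).mul hE
      convert this using 1
      rw [hT, hp i h]
      ext i j; fin_cases i <;> fin_cases j <;> simp

end Abstract

section Concrete

/-- The space `ℓ²(ℤ)`. -/
noncomputable abbrev L2Z := lp (fun _ : ℤ => ℂ) 2

/-- Weighted permutation operators exist. -/
theorem exists_weighted (σ : ℤ ≃ ℤ) (ε : ℤ → ℂ) (hε : ∀ n, ‖ε n‖ = 1) :
    ∃ X ∈ unitary (L2Z →L[ℂ] L2Z), ∀ (f : L2Z) (n : ℤ), X f n = ε n * f (σ n) := by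
  have main : ∀ (σ : ℤ ≃ ℤ) (ε : ℤ → ℂ), (∀ n, ‖ε n‖ = 1) →
      ∃ X : L2Z →ₗᵢ[ℂ] L2Z, ∀ (f : L2Z) (n : ℤ), X f n = ε n * f (σ n) := by
    intro σ ε hε
    have hmem : ∀ f : L2Z, Memℓp (fun n => ε n * f (σ n)) 2 := by
      intro f
      refine memℓp_gen ?_
      have := (lp.memℓp f).summable (by simp)
      simpa [hε, Function.comp_def] using σ.summable_iff.2 this
    let X : L2Z →ₗ[ℂ] L2Z :=
      { toFun := fun f => ⟨fun n => ε n * f (σ n), hmem f⟩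
        map_add' := fun f g => by
          ext n
          change ε n * (f (σ n) + g (σ n)) = ε n * f (σ n) + ε n * g (σ n)
          ring
        map_smul' := fun c f => by
          ext n
          change ε n * (c * f (σ n)) = c * (ε n * f (σ n))
          ring }
    refine ⟨⟨X, fun f => ?_⟩, fun f n => rfl⟩
    rw [lp.norm_eq_tsum_rpow (by simp), lp.norm_eq_tsum_rpow (by simp)]
    congr 1
    rw [← σ.tsum_eq (fun n => ‖f n‖ ^ (2 : ENNReal).toReal)]
    refine tsum_congr fun n => ?_
    change ‖ε n * f (σ n)‖ ^ _ = _
    rw [norm_mul, hε, one_mul]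
  obtain ⟨X, hX⟩ := main σ ε hε
  obtain ⟨Y, hY⟩ := main σ.symm (fun n => (ε (σ.symm n))⁻¹) (fun n => by simp [hε])
  have hne : ∀ n, ε n ≠ 0 := fun n h => by simpa [h] using hε n
  have hXY : ∀ f, X (Y f) = f := by
    intro f; ext n; rw [hX, hY]; simp [hne]
  have hYX : ∀ f, Y (X f) = f := by
    intro f; ext n; rw [hY, hX]; simp [hne]
  let e : L2Z ≃ₗᵢ[ℂ] L2Z :=
    { toLinearEquiv := LinearEquiv.ofLinearMap X.toLinearMap Y.toLinearMap
        (LinearMap.ext hXY) (LinearMap.ext hYX)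
      norm_map' := X.norm_map }
  refine ⟨(Unitary.linearIsometryEquiv.symm e : unitary (L2Z →L[ℂ] L2Z)), Subtype.property _, ?_⟩
  intro f n
  exact hX f n

/-- The concrete model. -/
theorem model : ∃ (V : H2 →ₗᵢ[ℂ] L2Z) (M : Submodule ℂ L2Z) (S R : L2Z →L[ℂ] L2Z),
    (∀ f, V f ∈ M) ∧ IsClosed (M : Set L2Z) ∧ S ∈ unitary (L2Z →L[ℂ] L2Z) ∧
    R ∈ unitary (L2Z →L[ℂ] L2Z) ∧ S * R = -(R * S) ∧ R * R = 1 ∧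
    Co (adjoint V.toContinuousLinearMap) M S !![0, 0; 1, 0] ∧
    Co (adjoint V.toContinuousLinearMap) M R !![1, 0; 0, -1] := by
  obtain ⟨S, hS, hSa⟩ := exists_weighted (Equiv.subRight 1) (fun _ => 1) (by simp)
  obtain ⟨R, hR, hRa⟩ := exists_weighted (Equiv.refl ℤ) (fun n => (-1) ^ n) (by simp)
  let M : Submodule ℂ L2Z :=
    { carrier := {k | ∀ n : ℤ, n < 0 → k n = 0}
      zero_mem' := fun n _ => rfl
      add_mem' := fun {a b} ha hb n hn => by
        rw [lp.coeFn_add, Pi.add_apply, ha n hn, hb n hn, add_zero]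
      smul_mem' := fun c a ha n hn => by
        rw [lp.coeFn_smul, Pi.smul_apply, ha n hn, smul_zero] }
  have hMm : ∀ k : L2Z, k ∈ M ↔ ∀ n : ℤ, n < 0 → k n = 0 := by
    intro k
    rfl
  let V0 : H2 →ₗ[ℂ] L2Z :=
    { toFun := fun f => lp.single 2 0 (f 0) + lp.single 2 1 (f 1)
      map_add' := fun f g => by
        simp only [PiLp.add_apply, lp.single_add]; abel
      map_smul' := fun c f => by
        simp only [PiLp.smul_apply, lp.single_smul, smul_add, RingHom.id_apply] }
  have hin : ∀ (f : H2) (k : L2Z), inner ℂ (V0 f) k = inner ℂ f !₂[k 0, k 1] := by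
    intro f k
    change inner ℂ (lp.single 2 0 (f 0) + lp.single 2 1 (f 1)) k = _
    rw [inner_add_left, lp.inner_single_left, lp.inner_single_left]
    simp [PiLp.inner_apply, Fin.sum_univ_two]
  have hV0a : ∀ (f : H2) (n : ℤ), V0 f n = (if n = 0 then f 0 else 0) + (if n = 1 then f 1 else 0) := by
    intro f n
    change (lp.single 2 0 (f 0) + lp.single 2 1 (f 1) : L2Z) n = _
    rw [lp.coeFn_add, Pi.add_apply, lp.single_apply, lp.single_apply]
    simp [Pi.single_apply]
  let V : H2 →ₗᵢ[ℂ] L2Z := V0.isometryOfInner (by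
    intro x y
    rw [hin]
    congr 1
    ext i
    fin_cases i <;> simp [hV0a])
  have hVa : ∀ (f : H2) (n : ℤ), V f n = (if n = 0 then f 0 else 0) + (if n = 1 then f 1 else 0) :=
    hV0a
  have hVd : ∀ k : L2Z, adjoint V.toContinuousLinearMap k = !₂[k 0, k 1] := by
    intro k
    refine ext_inner_left ℂ fun w => ?_
    rw [adjoint_inner_right]
    exact hin w k
  refine ⟨V, M, S, R, ?_, ?_, hS, hR, ?_, ?_, ?_, ?_⟩
  · intro f
    rw [hMm]
    intro n hn
    rw [hVa, if_neg (by omega), if_neg (by omega), add_zero]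
  · have : (M : Set L2Z) = ⋂ n : ℤ, ⋂ _ : n < 0, {k : L2Z | lp.evalCLM ℂ (fun _ : ℤ => ℂ) 2 n k = 0} := by
      ext k
      simp only [SetLike.mem_coe, hMm, Set.mem_iInter]
      rfl
    rw [this]
    exact isClosed_iInter fun n => isClosed_iInter fun _ =>
      isClosed_eq (ContinuousLinearMap.continuous _) continuous_const
  · ext k n
    change S (R k) n = -(R (S k) n)
    rw [hSa, hRa, hRa, hSa]
    simp only [Equiv.subRight_apply, Equiv.refl_apply, one_mul]
    rw [zpow_sub_one₀ (by norm_num)]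
    ring
  · ext k n
    change R (R k) n = k n
    rw [hRa, hRa]
    simp only [Equiv.refl_apply, ← mul_assoc]
    rw [← mul_zpow]; simp
  · intro k hk
    rw [hMm] at hk ⊢
    refine ⟨fun n hn => ?_, ?_⟩
    · rw [hSa, Equiv.subRight_apply, hk _ (by omega), mul_zero]
    · rw [hVd, hVd, Matrix.toEuclideanCLM_toLp, hSa, hSa]
      have := hk (-1) (by norm_num)
      ext i
      fin_cases i <;> simp [this, Matrix.mulVec, dotProduct, Fin.sum_univ_two]
  · intro k hk
    rw [hMm] at hk ⊢
    refine ⟨fun n hn => ?_, ?_⟩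
    · rw [hRa, Equiv.refl_apply, hk _ hn, mul_zero]
    · rw [hVd, hVd, Matrix.toEuclideanCLM_toLp, hRa, hRa]
      ext i
      fin_cases i <;> simp [Matrix.mulVec, dotProduct, Fin.sum_univ_two]

end Concrete

section Final

theorem contr_entries {T : M2} (h : opNorm2 T ≤ 1) (x y : ℂ) :
    ‖T 0 0 * x + T 0 1 * y‖ ^ 2 + ‖T 1 0 * x + T 1 1 * y‖ ^ 2 ≤ ‖x‖ ^ 2 + ‖y‖ ^ 2 := by
  have h1 := (Matrix.toEuclideanCLM (𝕜 := ℂ) T).le_of_opNorm_le h !₂[x, y]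
  rw [one_mul] at h1
  have h2 := pow_le_pow_left₀ (norm_nonneg _) h1 2
  rw [EuclideanSpace.norm_sq_eq, EuclideanSpace.norm_sq_eq, Matrix.toEuclideanCLM_toLp] at h2
  simpa [Fin.sum_univ_two, Matrix.mulVec, dotProduct] using h2

theorem contr_conj {T g : M2} (hg : g ∈ unitary M2) (h : opNorm2 T ≤ 1) :
    opNorm2 (g * T * star g) ≤ 1 := by
  unfold opNorm2 at *
  have hu : ∀ g ∈ unitary M2, ‖Matrix.toEuclideanCLM (𝕜 := ℂ) g‖ ≤ 1 := by
    intro g hg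
    have : Matrix.toEuclideanCLM (𝕜 := ℂ) g ∈ unitary (H2 →L[ℂ] H2) := by
      rw [Unitary.mem_iff] at *
      rw [← map_star, ← map_mul, ← map_mul, hg.1, hg.2]; simp
    exact (CStarRing.norm_of_mem_unitary this).le
  rw [map_mul, map_mul]
  have h1 := hu g hg
  have h2 := hu _ (Unitary.star_mem hg)
  calc _ ≤ ‖Matrix.toEuclideanCLM (𝕜 := ℂ) g * Matrix.toEuclideanCLM (𝕜 := ℂ) T‖
        * ‖Matrix.toEuclideanCLM (𝕜 := ℂ) (star g)‖ := norm_mul_le _ _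
    _ ≤ (‖Matrix.toEuclideanCLM (𝕜 := ℂ) g‖ * ‖Matrix.toEuclideanCLM (𝕜 := ℂ) T‖)
        * ‖Matrix.toEuclideanCLM (𝕜 := ℂ) (star g)‖ := by gcongr; exact norm_mul_le _ _
    _ ≤ (1 * 1) * 1 := by gcongr
    _ = 1 := by norm_num

/-- Membership in the unitary group for explicit matrices. -/
theorem unitary_mk (z w : ℂ) (h : ‖z‖ ^ 2 + ‖w‖ ^ 2 = 1) :
    (!![z, w; -star w, star z] : M2) ∈ unitary M2 := by
  have h' : z * star z + w * star w = 1 := by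
    simp only [Complex.star_def, Complex.mul_conj, Complex.normSq_eq_norm_sq]
    exact_mod_cast h
  have : (!![z, w; -star w, star z] : M2) * star !![z, w; -star w, star z] = 1 := by
    rw [Matrix.star_eq_conjTranspose]
    ext i j
    fin_cases i <;> fin_cases j <;>
      simp only [Matrix.mul_apply, Fin.sum_univ_two, Matrix.conjTranspose_apply] <;> simp
    · simpa using h'
    · ring
    · ring
    · have := h'; simp at this; linear_combination this
  rw [Unitary.mem_iff]
  exact ⟨mul_eq_one_comm.1 this, this⟩

/-- A singular matrix is unitarily equivalent to one with vanishing first row. -/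
theorem exists_conj (N : M2) (hN : ¬ IsUnit N) :
    ∃ g ∈ unitary M2, ∀ j, (g * N * star g) 0 j = 0 := by
  have hdet : N.det = 0 := by
    by_contra h
    exact hN ((Matrix.isUnit_iff_isUnit_det N).2 (isUnit_iff_ne_zero.2 h))
  obtain ⟨v, hv, hv0⟩ := Matrix.exists_vecMul_eq_zero_iff.2 hdet
  set s : ℝ := ‖v 0‖ ^ 2 + ‖v 1‖ ^ 2 with hs
  have hs0 : 0 < s := by
    have h0 : 0 ≤ s := by positivity
    refine lt_of_le_of_ne h0 fun h => hv ?_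
    have h1 : ‖v 0‖ = 0 := by nlinarith [sq_nonneg ‖v 0‖, sq_nonneg ‖v 1‖]
    have h2 : ‖v 1‖ = 0 := by nlinarith [sq_nonneg ‖v 0‖, sq_nonneg ‖v 1‖]
    ext i
    fin_cases i
    · simpa using h1
    · simpa using h2
  set c : ℂ := (((Real.sqrt s)⁻¹ : ℝ) : ℂ) with hc
  have hcn : ‖c‖ ^ 2 = s⁻¹ := by
    rw [hc, Complex.norm_real, Real.norm_eq_abs, sq_abs, inv_pow, Real.sq_sqrt hs0.le]
  refine ⟨!![c * v 0, c * v 1; -star (c * v 1), star (c * v 0)], unitary_mk _ _ ?_, fun j => ?_⟩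
  · rw [norm_mul, norm_mul, mul_pow, mul_pow, hcn, ← mul_add, ← hs]
    exact inv_mul_cancel₀ hs0.ne'
  · have h1 : ∀ j, v 0 * N 0 j + v 1 * N 1 j = 0 := by
      intro j
      have := congrFun hv0 j
      simpa [Matrix.vecMul, dotProduct, Fin.sum_univ_two] using this
    have h2 : ∀ j, (!![c * v 0, c * v 1; -star (c * v 1), star (c * v 0)] * N : M2) 0 j = 0 := by
      intro j
      rw [Matrix.mul_apply, Fin.sum_univ_two]
      have := h1 j
      simp only [Matrix.of_apply, Matrix.cons_val', Matrix.cons_val_zero, Matrix.cons_val_one]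
      linear_combination c * this
    rw [Matrix.mul_apply, Fin.sum_univ_two, h2, h2]
    simp

/-- A unitary glued from two orthogonal reducing projections. -/
theorem glue {K : Type} [NormedAddCommGroup K] [InnerProductSpace ℂ K] [CompleteSpace K]
    {P Q Z : K →L[ℂ] K} (hPs : star P = P) (hQs : star Q = Q) (hPQ : P * Q = 0) (hQP : Q * P = 0)
    (hPP : P * P = P) (hQQ : Q * Q = Q) (h1 : P + Q = 1) (hZ : Z ∈ unitary (K →L[ℂ] K))
    (hZQ : Commute Z Q) : P + Q * Z ∈ unitary (K →L[ℂ] K) := by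
  rw [Unitary.mem_iff] at hZ ⊢
  have e1 : Q * Z * P = 0 := by rw [← hZQ.eq, mul_assoc, hQP, mul_zero]
  have e2 : P * (star Z * Q) = 0 := by
    have := congrArg star e1
    rw [star_mul, star_mul, hPs, hQs, star_zero] at this
    exact this
  have e3 : (star Z * Q) * (Q * Z) = Q := by
    calc (star Z * Q) * (Q * Z) = star Z * ((Q * Q) * Z) := by simp only [mul_assoc]
      _ = Q := by rw [hQQ, ← hZQ.eq, ← mul_assoc, hZ.1, one_mul]
  have e4 : (Q * Z) * (star Z * Q) = Q := by
    calc (Q * Z) * (star Z * Q) = Q * (Z * star Z) * Q := by simp only [mul_assoc]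
      _ = Q := by rw [hZ.2, mul_one, hQQ]
  have e5 : P * (Q * Z) = 0 := by rw [← mul_assoc, hPQ, zero_mul]
  have e6 : star Z * Q * P = 0 := by rw [mul_assoc, hQP, mul_zero]
  rw [star_add, star_mul, hPs, hQs]
  constructor
  · rw [add_mul, mul_add, mul_add, e3, e5, e6, hPP, add_zero, zero_add, h1]
  · rw [add_mul, mul_add, mul_add, e4, e1, e2, hPP, add_zero, zero_add, h1]

theorem bound_caseA {T : M2} (h : opNorm2 T ≤ 1) (h01 : T 0 1 = 0) (h00 : T 0 0 = -T 1 1) :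
    ‖T 1 0‖ ≤ 1 - ‖T 1 1‖ ^ 2 := by
  have hc := contr_entries h
  rw [h01, h00] at hc
  generalize T 1 0 = q at hc ⊢
  generalize T 1 1 = p at hc ⊢
  have h1 := hc 0 1
  have h2 := hc 1 0
  simp only [mul_zero, mul_one, zero_add, add_zero, norm_neg, norm_zero, norm_one, zero_mul] at h1 h2
  have h3 := hc ((1 - ‖p‖ ^ 2 : ℝ) : ℂ) (star p * q)
  have e : q * ((1 - ‖p‖ ^ 2 : ℝ) : ℂ) + p * (star p * q) = q := by
    have : p * star p = ((‖p‖ ^ 2 : ℝ) : ℂ) := by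
      rw [Complex.star_def, Complex.mul_conj, Complex.normSq_eq_norm_sq]
    push_cast at this ⊢
    linear_combination q * this
  rw [e, zero_mul, add_zero, norm_mul, norm_mul, norm_neg, Complex.norm_real, norm_star,
    Real.norm_eq_abs, mul_pow, mul_pow, sq_abs] at h3
  have hD : 0 ≤ 1 - ‖p‖ ^ 2 := by nlinarith
  rcases hD.eq_or_lt with h0 | h0
  · rw [← h0]
    have : ‖q‖ ^ 2 ≤ 0 := by nlinarith
    have : ‖q‖ = 0 := by nlinarith [norm_nonneg q]
    rw [this]
  · refine abs_le_of_sq_le_sq' ?_ hD |>.2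
    have : (1 - ‖p‖ ^ 2) * ‖q‖ ^ 2 ≤ (1 - ‖p‖ ^ 2) * (1 - ‖p‖ ^ 2) ^ 2 := by nlinarith
    exact le_of_mul_le_mul_left this h0

theorem good_main {K : Type} [NormedAddCommGroup K] [InnerProductSpace ℂ K] [CompleteSpace K]
    {V : H2 →ₗᵢ[ℂ] K} {M : Submodule ℂ K} {S R : K →L[ℂ] K}
    (hV : ∀ f, V f ∈ M) (hM : IsClosed (M : Set K)) (hS : S ∈ unitary (K →L[ℂ] K))
    (hR : R ∈ unitary (K →L[ℂ] K)) (hSR : S * R = -(R * S)) (hRR : R * R = 1)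
    (hE : Co (adjoint V.toContinuousLinearMap) M S !![0, 0; 1, 0])
    (hJ : Co (adjoint V.toContinuousLinearMap) M R !![1, 0; 0, -1])
    {k : ℕ} (T : Fin k → M2) (hcontr : ∀ i, opNorm2 (T i) ≤ 1)
    (hanti : ∀ i j : Fin k, i ≠ j → T i * T j = -(T j * T i))
    (i0 : Fin k) (hne : T i0 ≠ 0) (hrow : ∀ j, T i0 0 j = 0) :
    Good (adjoint V.toContinuousLinearMap) M T := by
  have hent : ∀ i, i ≠ i0 → T i 0 1 * T i0 1 0 = 0 ∧ T i 0 1 * T i0 1 1 = 0 ∧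
      T i 1 1 * T i0 1 0 + T i0 1 0 * T i 0 0 + T i0 1 1 * T i 1 0 = 0 ∧
      T i 1 1 * T i0 1 1 + T i0 1 0 * T i 0 1 + T i0 1 1 * T i 1 1 = 0 := by
    intro i hi
    have h := hanti i i0 hi
    have e := fun a b => congrFun (congrFun h a) b
    simp only [Matrix.neg_apply, Matrix.mul_apply, Fin.sum_univ_two, hrow, mul_zero, zero_mul,
      zero_add, add_zero, neg_zero] at e
    have e00 := e 0 0
    have e01 := e 0 1
    have e10 := e 1 0
    have e11 := e 1 1
    simp only [hrow, mul_zero, zero_mul, zero_add, add_zero, neg_zero] at e00 e01 e10 e11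
    refine ⟨e00, e01, ?_, ?_⟩
    · linear_combination e10
    · linear_combination e11
  by_cases ha : T i0 1 1 = 0
  · -- nilpotent case
    have hb : T i0 1 0 ≠ 0 := by
      intro hb
      apply hne
      ext i j
      fin_cases i <;> fin_cases j
      · exact hrow 0
      · exact hrow 1
      · exact hb
      · exact ha
    have hform : ∀ i, T i 0 1 = 0 ∧ T i 0 0 = -T i 1 1 := by
      intro i
      by_cases hi : i = i0
      · rw [hi, hrow, hrow, ha]; simp
      · obtain ⟨h1, _, h3, _⟩ := hent i hi
        refine ⟨(mul_eq_zero.1 h1).resolve_right hb, ?_⟩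
        rw [ha] at h3
        have : T i0 1 0 * (T i 0 0 + T i 1 1) = 0 := by linear_combination h3
        have := (mul_eq_zero.1 this).resolve_left hb
        linear_combination this
    have hj : ∃ j0, ∀ i, i ≠ j0 → T i 1 1 = 0 := by
      by_cases h : ∃ j0, T j0 1 1 ≠ 0
      · obtain ⟨j0, hj0⟩ := h
        refine ⟨j0, fun i hi => ?_⟩
        have h := congrFun (congrFun (hanti i j0 hi) 0) 0
        simp only [Matrix.neg_apply, Matrix.mul_apply, Fin.sum_univ_two, (hform i).1, (hform j0).1,
          (hform i).2, (hform j0).2] at h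
        have h2 : T j0 1 1 * T i 1 1 = 0 := by linear_combination h / 2
        exact (mul_eq_zero.1 h2).resolve_left hj0
      · push Not at h
        exact ⟨i0, fun i _ => h i⟩
    obtain ⟨j0, hj0⟩ := hj
    refine caseA hM hS hR hSR hE hJ T j0 (fun i => T i 1 1) (fun i => T i 1 0) (fun i => ?_) hj0
      (fun i => bound_caseA (hcontr i) (hform i).1 (hform i).2)
    ext a b
    fin_cases a <;> fin_cases b <;> simp [(hform i).1, (hform i).2]
  · -- non-nilpotent case
    set a := T i0 1 1 with hadef
    set β := T i0 1 0 / a with hβ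
    have hbβ : T i0 1 0 = β * a := by rw [hβ]; field_simp
    have hN : T i0 = !![0, 0; β * a, a] := by
      ext i j
      fin_cases i <;> fin_cases j <;> simp [hrow, hbβ, hadef]
    have hform : ∀ i, i ≠ i0 → T i = !![T i 0 0, 0; -(β * T i 0 0), 0] := by
      intro i hi
      obtain ⟨_, h2, h3, h4⟩ := hent i hi
      have h01 : T i 0 1 = 0 := (mul_eq_zero.1 h2).resolve_right ha
      have h11 : T i 1 1 = 0 := by
        rw [h01] at h4
        have : a * T i 1 1 = 0 := by linear_combination h4 / 2
        exact (mul_eq_zero.1 this).resolve_left ha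
      have h10 : T i 1 0 = -(β * T i 0 0) := by
        rw [h11, hbβ] at h3
        have : a * (T i 1 0 + β * T i 0 0) = 0 := by linear_combination h3
        have := (mul_eq_zero.1 this).resolve_left ha
        linear_combination this
      ext x y
      fin_cases x <;> fin_cases y <;> simp [h01, h11, h10]
    have hanorm : ‖a‖ ^ 2 * (1 + ‖β‖ ^ 2) ≤ 1 := by
      have h := contr_entries (hcontr i0) (star (T i0 1 0)) (star a)
      rw [hrow, hrow, ← hadef] at h
      have e : ∀ z : ℂ, z * star z = ((‖z‖ ^ 2 : ℝ) : ℂ) := by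
        intro z; rw [Complex.star_def, Complex.mul_conj, Complex.normSq_eq_norm_sq]
      rw [e, e, ← Complex.ofReal_add, Complex.norm_real, Real.norm_eq_abs, sq_abs, norm_star,
        norm_star, hbβ, norm_mul] at h
      simp only [zero_mul, add_zero, norm_zero, mul_pow] at h
      have hapos : 0 < ‖a‖ ^ 2 := by positivity
      have hpos : 0 < ‖a‖ ^ 2 * (1 + ‖β‖ ^ 2) := by positivity
      have h' : (‖a‖ ^ 2 * (1 + ‖β‖ ^ 2)) * (‖a‖ ^ 2 * (1 + ‖β‖ ^ 2)) ≤
          (‖a‖ ^ 2 * (1 + ‖β‖ ^ 2)) * 1 := by nlinarith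
      exact le_of_mul_le_mul_left h' hpos
    have hcnorm : ∀ i, i ≠ i0 → ‖T i 0 0‖ ^ 2 * (1 + ‖β‖ ^ 2) ≤ 1 := by
      intro i hi
      have h := contr_entries (hcontr i) 1 0
      have h10 : T i 1 0 = -(β * T i 0 0) := by
        have := congrFun (congrFun (hform i hi) 1) 0
        simpa using this
      rw [h10] at h
      simp only [mul_one, mul_zero, add_zero, norm_neg, norm_mul, norm_one, norm_zero] at h
      nlinarith
    by_cases hβ0 : β = 0
    · -- orthogonal projections
      rw [hβ0] at hN hform hanorm hcnorm
      have hRs : star R = R := by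
        calc star R = star R * (R * R) := by rw [hRR, mul_one]
          _ = R := by rw [← mul_assoc, (Unitary.mem_iff.1 hR).1, one_mul]
      set P : K →L[ℂ] K := (1 / 2 : ℂ) • (1 + (-1 : ℂ) • R) with hP
      set Q : K →L[ℂ] K := (1 / 2 : ℂ) • (1 + R) with hQ
      have hPs : star P = P := by rw [hP]; simp [hRs]
      have hQs : star Q = Q := by rw [hQ]; simp [hRs]
      have hPQ : P * Q = 0 := by
        simp only [hP, hQ, mul_add, add_mul, smul_mul_assoc, mul_smul_comm, one_mul, mul_one, hRR]
        module
      have hQP : Q * P = 0 := by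
        simp only [hP, hQ, mul_add, add_mul, smul_mul_assoc, mul_smul_comm, one_mul, mul_one, hRR]
        module
      have hPP : P * P = P := by
        simp only [hP, mul_add, add_mul, smul_mul_assoc, mul_smul_comm, one_mul, mul_one, hRR]
        module
      have hQQ : Q * Q = Q := by
        simp only [hQ, mul_add, add_mul, smul_mul_assoc, mul_smul_comm, one_mul, mul_one, hRR]
        module
      have hPQ1 : P + Q = 1 := by simp only [hP, hQ]; module
      have hZR : Commute (S * S) R := by
        change S * S * R = R * (S * S)
        rw [mul_assoc, hSR, mul_neg, ← mul_assoc, hSR, neg_mul, neg_neg, mul_assoc]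
      have hZP : Commute (S * S) P :=
        ((Commute.one_right _).add_right (hZR.smul_right _)).smul_right _
      have hZQ : Commute (S * S) Q := ((Commute.one_right _).add_right hZR).smul_right _
      have hZ := mul_mem hS hS
      have hX := glue hPs hQs hPQ hQP hPP hQQ hPQ1 hZ hZQ
      have hY := glue hQs hPs hQP hPQ hQQ hPP (by rw [add_comm]; exact hPQ1) hZ hZP
      have cPQ : Commute P Q := by change P * Q = Q * P; rw [hPQ, hQP]
      have hXY : Commute (P + Q * (S * S)) (Q + P * (S * S)) := by
        refine Commute.add_left ?_ (Commute.mul_left ?_ ?_)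
        · exact cPQ.add_right ((Commute.refl P).mul_right hZP.symm)
        · exact (Commute.refl Q).add_right (cPQ.symm.mul_right hZQ.symm)
        · exact hZQ.add_right (hZP.mul_right (Commute.refl _))
      have hPco : Co (adjoint V.toContinuousLinearMap) M P !![0, 0; 0, 1] := by
        have := (Co.one.add (hJ.smul (-1))).smul (1 / 2)
        convert this using 1
        ext i j
        fin_cases i <;> fin_cases j <;> simp
        norm_num
      have hQco : Co (adjoint V.toContinuousLinearMap) M Q !![1, 0; 0, 0] := by
        have := (Co.one.add hJ).smul (1 / 2)
        convert this using 1
        ext i j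
        fin_cases i <;> fin_cases j <;> simp
        norm_num
      have hXco : Co (adjoint V.toContinuousLinearMap) M (P + Q * (S * S)) !![0, 0; 0, 1] := by
        convert hPco.add (hQco.mul (hE.mul hE)) using 1
        ext i j
        fin_cases i <;> fin_cases j <;> simp
      have hYco : Co (adjoint V.toContinuousLinearMap) M (Q + P * (S * S)) !![1, 0; 0, 0] := by
        convert hQco.add (hPco.mul (hE.mul hE)) using 1
        ext i j
        fin_cases i <;> fin_cases j <;> simp
      refine caseB hM hX hY hXY hXco hYco ?_ T fun i => ?_
      · ext i j
        fin_cases i <;> fin_cases j <;> simp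
      · by_cases hi : i = i0
        · refine ⟨a, ?_, Or.inl ?_⟩
          · simp at hanorm; exact hanorm
          · rw [hi, hN]
            ext i j
            fin_cases i <;> fin_cases j <;> simp
        · refine ⟨T i 0 0, ?_, Or.inr ?_⟩
          · have := hcnorm i hi; simp at this; exact this
          · rw [hform i hi]
            ext i j
            fin_cases i <;> fin_cases j <;> simp
    · -- oblique projections
      set s : ℝ := Real.sqrt (1 + ‖β‖ ^ 2) with hs
      have hs2 : s ^ 2 = 1 + ‖β‖ ^ 2 := Real.sq_sqrt (by positivity)
      have hβpos : 0 < ‖β‖ ^ 2 := by positivity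
      have hs0 : 0 < s := Real.sqrt_pos.2 (by positivity)
      have hs1 : 1 < s := by nlinarith
      set r : ℂ := ((s⁻¹ : ℝ) : ℂ) with hr
      have hsc : (s : ℂ) ≠ 0 := by exact_mod_cast hs0.ne'
      have hrs : star r = r := by rw [hr, Complex.star_def, Complex.conj_ofReal]
      have hr0 : r ≠ 0 := by rw [hr]; exact_mod_cast inv_ne_zero hs0.ne'
      have hrn : ‖r‖ = s⁻¹ := by
        rw [hr, Complex.norm_real, Real.norm_eq_abs, abs_of_pos (inv_pos.2 hs0)]
      have hr1 : 1 - r ^ 2 ≠ 0 := by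
        have h1 : s⁻¹ < 1 := inv_lt_one_of_one_lt₀ hs1
        have h2 : 0 < s⁻¹ := inv_pos.2 hs0
        have h3 : (1 : ℝ) - s⁻¹ ^ 2 ≠ 0 := by nlinarith
        rw [hr]; exact_mod_cast h3
      have hg : (!![r * β, r; -star r, star (r * β)] : M2) ∈ unitary M2 := by
        apply unitary_mk
        rw [norm_mul, hrn, mul_pow, inv_pow]
        have : s ^ 2 ≠ 0 := by positivity
        field_simp
        linarith
      obtain ⟨G, hG, hGco, _⟩ := lift V hV hg
      have hX := mul_mem hS hG
      have hXco : Co (adjoint V.toContinuousLinearMap) M (S * G) !![0, 0; r * β, r] := by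
        convert hE.mul hGco using 1
        ext i j
        fin_cases i <;> fin_cases j <;> simp
      obtain ⟨Y, hY, hYc, hYco⟩ := mob (Vd := adjoint V.toContinuousLinearMap) hM hX (-r)
        (by rw [norm_neg, hrn]; exact (inv_lt_one_of_one_lt₀ hs1).le)
      have hYB := hYco !![0, 0; r * β, r]
        (1 + (r ^ 2 / (1 - r ^ 2)) • !![0, 0; β, 1]) hXco (by
          rw [star_neg, hrs]
          ext i j
          fin_cases i <;> fin_cases j <;> simp [Matrix.mul_apply, Fin.sum_univ_two] <;>
            field_simp <;> ring)
      have eB : (1 + (r ^ 2 / (1 - r ^ 2)) • !![0, 0; β, 1]) * (!![0, 0; r * β, r] + -r • 1)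
          = (!![-r, 0; r * β, 0] : M2) := by
        ext i j
        fin_cases i <;> fin_cases j <;> simp [Matrix.mul_apply, Fin.sum_univ_two]
        ring
      rw [eB] at hYB
      have hbd : ∀ z : ℂ, ‖z‖ ^ 2 * (1 + ‖β‖ ^ 2) ≤ 1 → ‖z / r‖ ≤ 1 := by
        intro z hz
        rw [norm_div, hrn, div_inv_eq_mul]
        rw [← hs2, ← mul_pow] at hz
        exact (sq_le_one_iff₀ (by positivity)).1 hz
      refine caseB hM hX hY (hYc _ (Commute.refl _)).symm hXco hYB ?_ T fun i => ?_
      · ext i j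
        fin_cases i <;> fin_cases j <;> simp [Matrix.mul_apply, Fin.sum_univ_two]
        ring
      · by_cases hi : i = i0
        · refine ⟨a / r, hbd _ hanorm, Or.inl ?_⟩
          rw [hi, hN]
          ext i j
          fin_cases i <;> fin_cases j <;> simp <;> field_simp
        · refine ⟨-(T i 0 0 / r), by rw [norm_neg]; exact hbd _ (hcnorm i hi), Or.inr ?_⟩
          rw [hform i hi]
          ext i j
          fin_cases i <;> fin_cases j <;> simp <;> field_simp

end Final

end Helpers

/-- An anti-commuting tuple of contractions on `ℂ²` containing a non-zero non-invertible matrix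
admits a dilation to a `q̃`-commuting tuple of unitaries with `q̃ ⊆ {1, -1}`. -/
theorem stmt6 (k : ℕ) (T : Fin k → Matrix (Fin 2) (Fin 2) ℂ)
    (hcontr : ∀ i, opNorm2 (T i) ≤ 1)
    (hanti : ∀ i j : Fin k, i < j → T i * T j = -(T j * T i))
    (hni : ∃ i, T i ≠ 0 ∧ ¬ IsUnit (T i)) :
    ∃ (K : Type) (_ : NormedAddCommGroup K) (_ : InnerProductSpace ℂ K) (_ : CompleteSpace K)
      (qt : Fin k → Fin k → ℂ) (U : Fin k → K →L[ℂ] K)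
      (V : EuclideanSpace ℂ (Fin 2) →ₗᵢ[ℂ] K),
      (∀ i j : Fin k, i < j → (qt i j = 1 ∨ qt i j = -1)) ∧
      (∀ i, U i ∈ unitary (K →L[ℂ] K)) ∧
      (∀ i j : Fin k, i < j → U i * U j = qt i j • (U j * U i)) ∧
      (∀ m : Fin k → ℕ,
        Matrix.toEuclideanCLM (𝕜 := ℂ) (((List.finRange k).map (fun i => T i ^ m i)).prod) =
          (ContinuousLinearMap.adjoint V.toContinuousLinearMap) ∘L
            (((List.finRange k).map (fun i => U i ^ m i)).prod) ∘L V.toContinuousLinearMap) := by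

  obtain ⟨V, M, S, R, hV, hM, hS, hR, hSR, hRR, hE, hJ⟩ := model
  obtain ⟨i0, hne, hnu⟩ := hni
  obtain ⟨g, hg, hrow⟩ := exists_conj _ hnu
  have hg' := Unitary.mem_iff.1 hg
  have hanti' : ∀ i j : Fin k, i ≠ j → T i * T j = -(T j * T i) := by
    intro i j hij
    rcases lt_or_gt_of_ne hij with h | h
    · exact hanti i j h
    · rw [hanti j i h, neg_neg]
  have hprod : ∀ a b : M2, (g * a * star g) * (g * b * star g) = g * (a * b) * star g := by
    intro a b
    calc (g * a * star g) * (g * b * star g) = g * a * (star g * g) * b * star g := by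
          simp only [mul_assoc]
      _ = _ := by rw [hg'.1, mul_one]; simp only [mul_assoc]
  refine Good.dilate hV (Good.conj hV hg ?_)
  refine good_main hV hM hS hR hSR hRR hE hJ (fun i => g * T i * star g)
    (fun i => contr_conj hg (hcontr i)) (fun i j hij => ?_) i0 (fun h => hne ?_) hrow
  · simp only [hprod]
    rw [hanti' i j hij, mul_neg, neg_mul]
  · have h0 : g * T i0 * star g = 0 := h
    calc T i0 = (star g * g) * T i0 * (star g * g) := by rw [hg'.1]; simp
      _ = star g * (g * T i0 * star g) * g := by simp only [mul_assoc]
      _ = 0 := by rw [h0]; simp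
end

section
/- Let T₁,…,T_k be invertible 2×2 complex matrices satisfying T_iT_j = −T_jT_i for all 1 ≤ i < j ≤ k. Then k ≤ 3. -/
/-- An anti-commuting tuple of invertible `2 × 2` complex matrices has at most `3` members. -/
theorem stmt7 (k : ℕ) (T : Fin k → Matrix (Fin 2) (Fin 2) ℂ)
    (hinv : ∀ i, IsUnit (T i))
    (hanti : ∀ i j : Fin k, i < j → T i * T j = -(T j * T i)) :
    k ≤ 3 := by
  by_contra! hk
  have hanti' : ∀ i j : Fin k, i ≠ j → T i * T j = -(T j * T i) := by
    intro i j hij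
    rcases lt_or_gt_of_ne hij with h | h
    · exact hanti i j h
    · rw [hanti j i h, neg_neg]
  have horth : ∀ i j : Fin k, i ≠ j → (T i * T j).trace = 0 := by
    intro i j hij
    have h := congrArg Matrix.trace (hanti' i j hij)
    rw [Matrix.trace_neg, Matrix.trace_mul_comm (T j)] at h
    exact self_eq_neg.mp h
  have htr : ∀ i, (T i).trace = 0 := by
    intro i
    obtain ⟨j, hj⟩ : ∃ j : Fin k, i ≠ j := by
      have : Nontrivial (Fin k) := Fin.nontrivial_iff_two_le.mpr (by omega)
      obtain ⟨j, hj⟩ := exists_ne i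
      exact ⟨j, hj.symm⟩
    obtain ⟨u, hu⟩ := hinv j
    have h1 : T i = -((u : Matrix (Fin 2) (Fin 2) ℂ) * T i * (u⁻¹ : (Matrix (Fin 2) (Fin 2) ℂ)ˣ)) := by
      have h := hanti' i j hj
      rw [← hu] at h
      rw [← neg_mul, ← h, mul_assoc, Units.mul_inv, mul_one]
    have h2 := congrArg Matrix.trace h1
    rw [Matrix.trace_neg, Matrix.trace_mul_comm, ← mul_assoc, Units.inv_mul, one_mul] at h2
    exact self_eq_neg.mp h2
  have h11 : ∀ i, T i 1 1 = - T i 0 0 := by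
    intro i
    have h := htr i
    rw [Matrix.trace_fin_two] at h
    linear_combination h
  have hli : LinearIndependent ℂ (fun i => (![T i 0 0, T i 0 1, T i 1 0] : Fin 3 → ℂ)) := by
    rw [Fintype.linearIndependent_iff]
    intro g hg j
    have e0 := congrFun hg 0
    have e1 := congrFun hg 1
    have e2 := congrFun hg 2
    simp [Finset.sum_apply] at e0 e1 e2
    have hs : ∑ i, g i • T i = 0 := by
      ext a b
      fin_cases a <;> fin_cases b <;> simp [Matrix.sum_apply, h11, e0, e1, e2]
    have h := congrArg (fun M => (T j * M).trace) hs
    simp only [Finset.mul_sum, Matrix.trace_sum, Matrix.mul_smul, Matrix.trace_smul, mul_zero,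
      Matrix.trace_zero] at h
    rw [Finset.sum_eq_single j (fun i _ hi => by rw [horth j i hi.symm, smul_zero])
      (by simp)] at h
    have hd : (T j).det ≠ 0 := ((Matrix.isUnit_iff_isUnit_det _).mp (hinv j)).ne_zero
    have hq : (T j * T j).trace = -2 * (T j).det := by
      rw [Matrix.trace_fin_two, Matrix.det_fin_two, Matrix.mul_apply, Matrix.mul_apply]
      simp only [Fin.sum_univ_two, h11]
      ring
    rw [hq, smul_eq_mul] at h
    simpa [hd] using h
  have := hli.fintype_card_le_finrank
  simp at this
  omega
end
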